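/- arXiv:1810.05266 — 4 statements merged into one kernel-verified Lean document; each statement's English description precedes it below -/
import Mathlib

section
/- If P is a solvable distribution on a vertex-transitive graph G with maximum degree Δ ≥ 3, decomposed into disjoint units U_1,…,U_t, then |P| ≥ ( ((Δ−1)/(Δ−2))|V(G)| + UE(P) − (1/(Δ−2)) Σ_{i=1}^t cov(U_i) ) / eff(v), where UE(P) = Σ_i TE(U_i) and eff(v) = Σ_{i=0}^{diam(G)} (1/2)^i |N_i(v)|. -/
open Finset

/-- A pebbling move: remove two pebbles from `src`, add one to `tgt`. -/
structure PMove (V : Type*) where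
  src : V
  tgt : V

/-- Result of applying one pebbling move to a distribution. -/
def applyMove {V : Type*} [DecidableEq V] (p : V → ℕ) (m : PMove V) : V → ℕ :=
  fun w => if w = m.src then p w - 2 else if w = m.tgt then p w + 1 else p w

/-- A list of moves is executable: each move goes along an edge and has
two pebbles available at its source. -/
def Executable {V : Type*} [DecidableEq V] (G : SimpleGraph V) :
    (V → ℕ) → List (PMove V) → Prop
  | _, [] => True
  | p, m :: ms => G.Adj m.src m.tgt ∧ 2 ≤ p m.src ∧ Executable G (applyMove p m) ms

/-- The distribution obtained after applying a sequence of moves. -/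
def applySeq {V : Type*} [DecidableEq V] (p : V → ℕ) (σ : List (PMove V)) : V → ℕ :=
  σ.foldl applyMove p

/-- `v` is `k`-reachable under `p`. -/
def KReachable {V : Type*} [DecidableEq V] (G : SimpleGraph V) (p : V → ℕ) (k : ℕ) (v : V) :
    Prop :=
  ∃ σ : List (PMove V), Executable G p σ ∧ k ≤ applySeq p σ v

/-- `v` is reachable under `p`: some pebbling sequence puts a pebble on `v`. -/
def Reachable' {V : Type*} [DecidableEq V] (G : SimpleGraph V) (p : V → ℕ) (v : V) : Prop :=
  KReachable G p 1 v

/-- The maximal number of pebbles that can be moved to `v`. -/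
noncomputable def reach {V : Type*} [DecidableEq V] (G : SimpleGraph V) (p : V → ℕ) (v : V) :
    ℕ :=
  sSup {k | KReachable G p k v}

/-- The excess of `v` under `p`. -/
noncomputable def exc {V : Type*} [DecidableEq V] (G : SimpleGraph V) (p : V → ℕ) (v : V) :
    ℕ :=
  reach G p v - 1

/-- The total excess of `p`. -/
noncomputable def TE {V : Type*} [Fintype V] [DecidableEq V] (G : SimpleGraph V)
    (p : V → ℕ) : ℕ :=
  ∑ v, exc G p v

/-- `p` is solvable: every vertex is reachable. -/
def Solvable {V : Type*} [DecidableEq V] (G : SimpleGraph V) (p : V → ℕ) : Prop :=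
  ∀ v, Reachable' G p v

/-- The number of vertices reachable under `p`. -/
noncomputable def cov {V : Type*} [DecidableEq V] (G : SimpleGraph V) (p : V → ℕ) : ℕ :=
  Set.ncard {v | Reachable' G p v}

/-- The number of cooperation vertices of the pair `(p, q)`. -/
noncomputable def coop {V : Type*} [DecidableEq V] (G : SimpleGraph V) (p q : V → ℕ) : ℕ :=
  Set.ncard {v | Reachable' G (p + q) v ∧ ¬ Reachable' G p v ∧ ¬ Reachable' G q v}

/-- The number of double covered vertices of the pair `(p, q)`. -/
noncomputable def DC {V : Type*} [DecidableEq V] (G : SimpleGraph V) (p q : V → ℕ) : ℕ :=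
  Set.ncard {v | Reachable' G p v ∧ Reachable' G q v}

/-- The cooperation excess between `p` and `q`. -/
noncomputable def CE {V : Type*} [Fintype V] [DecidableEq V] (G : SimpleGraph V)
    (p q : V → ℕ) : ℤ :=
  (TE G (p + q) : ℤ) - TE G p - TE G q

/-- The effect of a pebble placed at `v`. -/
noncomputable def eff {V : Type*} (G : SimpleGraph V) (v : V) : ℚ :=
  ∑ i ∈ Finset.range (G.diam + 1), (1 / 2 : ℚ) ^ i * (Set.ncard {u | G.dist v u = i})

/-- The optimal pebbling number of `G`. -/
noncomputable def piOpt {V : Type*} [Fintype V] [DecidableEq V] (G : SimpleGraph V) : ℕ :=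
  sInf {k | ∃ p : V → ℕ, Solvable G p ∧ ∑ v, p v = k}


namespace Peb

variable {V : Type*} [DecidableEq V] {G : SimpleGraph V}

theorem applySeq_cons (p : V → ℕ) (m : PMove V) (σ : List (PMove V)) :
    applySeq p (m :: σ) = applySeq (applyMove p m) σ := rfl

theorem applySeq_nil (p : V → ℕ) : applySeq p [] = p := rfl

theorem exec_cons {p : V → ℕ} {m : PMove V} {σ : List (PMove V)} :
    Executable G p (m :: σ) ↔ G.Adj m.src m.tgt ∧ 2 ≤ p m.src ∧ Executable G (applyMove p m) σ :=
  Iff.rfl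

theorem exec_append {p : V → ℕ} {σ τ : List (PMove V)} :
    Executable G p (σ ++ τ) ↔ Executable G p σ ∧ Executable G (applySeq p σ) τ := by
  induction σ generalizing p with
  | nil => simp [Executable, applySeq]
  | cons m σ ih => simp only [List.cons_append, exec_cons, ih, applySeq_cons]; tauto

theorem applySeq_append {p : V → ℕ} {σ τ : List (PMove V)} :
    applySeq p (σ ++ τ) = applySeq (applySeq p σ) τ := by
  simp [applySeq, List.foldl_append]

/-- The change made by a sequence does not depend on the distribution. -/
theorem diff {σ : List (PMove V)} {p q : V → ℕ} (hp : Executable G p σ) (hq : Executable G q σ)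
    (w : V) : applySeq p σ w + q w = applySeq q σ w + p w := by
  induction σ generalizing p q with
  | nil => simp [applySeq_nil]; omega
  | cons m σ ih =>
    obtain ⟨ha, h2, hp⟩ := hp
    obtain ⟨-, h2', hq⟩ := hq
    have := ih hp hq
    rw [applySeq_cons, applySeq_cons]
    by_cases h1 : w = m.src
    · subst h1; simp only [applyMove, if_true] at this ⊢; omega
    · by_cases h3 : w = m.tgt
      · simp only [applyMove, if_neg h1, if_pos h3] at this ⊢; omega
      · simp only [applyMove, if_neg h1, if_neg h3] at this ⊢; omega

theorem exec_off {σ : List (PMove V)} {p q : V → ℕ} {S : Set V}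
    (hS : ∀ m ∈ σ, m.src ∉ S) (hpq : ∀ w, w ∉ S → p w ≤ q w)
    (hp : Executable G p σ) : Executable G q σ := by
  induction σ generalizing p q with
  | nil => trivial
  | cons m σ ih =>
    obtain ⟨ha, h2, hp⟩ := hp
    have hm : m.src ∉ S := hS m (by simp)
    refine ⟨ha, h2.trans (hpq _ hm), ih (fun m' hm' => hS m' (by simp [hm'])) ?_ hp⟩
    intro w hw
    have := hpq w hw
    simp only [applyMove]
    split_ifs <;> omega

theorem exec_mono {σ : List (PMove V)} {p q : V → ℕ} (hpq : ∀ w, p w ≤ q w)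
    (hp : Executable G p σ) : Executable G q σ :=
  exec_off (S := ∅) (by simp) (fun w _ => hpq w) hp

theorem apply_mono {σ : List (PMove V)} {p q : V → ℕ} (hpq : ∀ w, p w ≤ q w)
    (hp : Executable G p σ) (w : V) : applySeq p σ w ≤ applySeq q σ w := by
  have := diff hp (exec_mono hpq hp) w
  have := hpq w
  omega

/-- Removing one pebble costs at most one pebble at the end. -/
theorem rm {σ : List (PMove V)} {p q : V → ℕ} {a : V}
    (hpq : ∀ w, p w ≤ q w + if w = a then 1 else 0) (hp : Executable G p σ) :
    ∃ τ : List (PMove V), τ.Sublist σ ∧ Executable G q τ ∧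
      ∃ b, ∀ w, applySeq p σ w ≤ applySeq q τ w + if w = b then 1 else 0 := by
  induction σ generalizing p q a with
  | nil => exact ⟨[], by simp, trivial, a, hpq⟩
  | cons m σ ih =>
    obtain ⟨ha, h2, hp⟩ := hp
    by_cases h : 2 ≤ q m.src
    · have : ∀ w, applyMove p m w ≤ applyMove q m w + if w = a then 1 else 0 := by
        intro w
        have := hpq w
        simp only [applyMove]
        by_cases h1 : w = m.src
        · subst h1; simp only [if_true]; split_ifs at this ⊢ <;> omega
        · simp only [if_neg h1]; split_ifs at this ⊢ <;> omega
      obtain ⟨τ, h1, h2, h3⟩ := ih this hp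
      exact ⟨m :: τ, h1.cons_cons m, ⟨ha, h, h2⟩, h3⟩
    · have : ∀ w, applyMove p m w ≤ q w + if w = m.tgt then 1 else 0 := by
        intro w
        have h3 := hpq w
        have h4 := hpq m.src
        have hsa : m.src = a := by
          by_contra hne
          rw [if_neg hne] at h4; omega
        rw [if_pos hsa] at h4
        simp only [applyMove]
        by_cases h1 : w = m.src
        · subst h1; simp only [if_true]; omega
        · have : w ≠ a := hsa ▸ h1
          simp only [if_neg h1, if_neg this] at h3 ⊢; split_ifs at ⊢ <;> omega
      obtain ⟨τ, h1, h2, h3⟩ := ih this hp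
      exact ⟨τ, h1.cons m, h2, h3⟩

/-- No move out of the target is needed. -/
theorem nc (v : V) {σ : List (PMove V)} {p : V → ℕ} (hp : Executable G p σ) :
    ∃ τ : List (PMove V), τ.Sublist σ ∧ Executable G p τ ∧ (∀ m ∈ τ, m.src ≠ v) ∧
      applySeq p σ v ≤ applySeq p τ v := by
  induction σ generalizing p with
  | nil => exact ⟨[], by simp, trivial, by simp, le_rfl⟩
  | cons m σ ih =>
    obtain ⟨ha, h2, hp⟩ := hp
    obtain ⟨τ, s1, e1, o1, f1⟩ := ih hp
    by_cases hm : m.src = v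
    · set q : V → ℕ := fun w => if w = v then p w - 2 else p w with hq
      have hle : ∀ w, applyMove p m w ≤ q w + if w = m.tgt then 1 else 0 := by
        intro w; simp only [applyMove, hq, hm]; split_ifs <;> omega
      obtain ⟨τ', s2, e2, b, f2⟩ := rm hle e1
      have hqp : ∀ w, q w ≤ p w := by intro w; simp only [hq]; split_ifs <;> omega
      have e3 := exec_mono hqp e2
      refine ⟨τ', (s2.trans s1).cons m, e3, fun m' hm' => o1 m' (s2.subset hm'), ?_⟩
      have d := diff e2 e3 v
      have f3 := f2 v
      have : q v = p v - 2 := by simp [hq]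
      rw [hm] at h2
      rw [applySeq_cons]
      split_ifs at f3 <;> omega
    · refine ⟨m :: τ, s1.cons_cons m, ⟨ha, h2, e1⟩, ?_, f1⟩
      intro m' hm'
      rcases List.mem_cons.1 hm' with rfl | h
      · exact hm
      · exact o1 m' h

/-- Removing one move into `x` from a sequence without moves out of `x`. -/
theorem remove_one {x y : V} {σ : List (PMove V)} {p : V → ℕ} (hp : Executable G p σ)
    (ho : ∀ m ∈ σ, m.src ≠ x) (hm : (⟨y, x⟩ : PMove V) ∈ σ) :
    ∃ τ : List (PMove V), τ.length + 1 = σ.length ∧ Executable G p τ ∧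
      2 ≤ applySeq p τ y ∧ applySeq p σ x ≤ applySeq p τ x + 1 := by
  induction σ generalizing p with
  | nil => simp at hm
  | cons m σ ih =>
    obtain ⟨ha, h2, hp⟩ := hp
    by_cases h : m = ⟨y, x⟩
    · subst h
      have e := exec_off (S := {x}) (q := p) (fun m' hm' => by simpa using ho m' (by simp [hm']))
        (fun w hw => by
          have : w ≠ x := by simpa using hw
          simp only [applyMove, if_neg this]; split_ifs <;> omega) hp
      refine ⟨σ, by simp, e, ?_, ?_⟩
      · have := diff e hp y
        simp only [applyMove, if_true] at this
        simp only at h2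
        omega
      · have := diff e hp x
        have hne : x ≠ y := fun h => ha.ne h.symm
        simp only [applyMove, if_neg hne, if_true] at this
        rw [applySeq_cons]
        omega
    · have hm' : (⟨y, x⟩ : PMove V) ∈ σ := by
        rcases List.mem_cons.1 hm with h' | h'
        · exact absurd h'.symm h
        · exact h'
      obtain ⟨τ, l, e, f1, f2⟩ := ih hp (fun m' hm' => ho m' (by simp [hm'])) hm'
      exact ⟨m :: τ, by simp [l], ⟨ha, h2, e⟩, f1, f2⟩

/-- If all moves into `x` come from `z`, then omit all of them. -/
theorem remove_all {x z : V} {σ : List (PMove V)} {p q : V → ℕ} {a : ℕ} (hp : Executable G p σ)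
    (ho : ∀ m ∈ σ, m.src ≠ x) (hz : ∀ m ∈ σ, m.tgt = x → m.src = z) (hzx : z ≠ x)
    (hpq : ∀ w, w ≠ x → p w ≤ q w) (ha : p z + a ≤ q z) :
    ∃ τ : List (PMove V), (∀ m ∈ τ, m.src ≠ x ∧ m.tgt ≠ x) ∧ Executable G q τ ∧
      a + 2 * applySeq p σ x ≤ applySeq q τ z + 2 * p x := by
  induction σ generalizing p q a with
  | nil => exact ⟨[], by simp, trivial, by simp only [applySeq_nil]; omega⟩
  | cons m σ ih =>
    obtain ⟨hadj, h2, hp⟩ := hp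
    have hs : m.src ≠ x := ho m (by simp)
    have ho' : ∀ m ∈ σ, m.src ≠ x := fun m' hm' => ho m' (by simp [hm'])
    have hz' : ∀ m ∈ σ, m.tgt = x → m.src = z := fun m' hm' => hz m' (by simp [hm'])
    by_cases h : m.tgt = x
    · have hsz := hz m (by simp) h
      obtain ⟨τ, t1, t2, t3⟩ := ih (q := q) (a := a + 2) hp ho' hz' (by
        intro w hw
        have := hpq w hw
        simp only [applyMove, h, if_neg hw]; split_ifs <;> omega) (by
        simp only [applyMove, hsz, if_true]; rw [hsz] at h2; omega)
      refine ⟨τ, t1, t2, ?_⟩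
      simp only [applyMove, h, if_neg hs.symm, if_true] at t3
      rw [applySeq_cons]
      omega
    · obtain ⟨τ, t1, t2, t3⟩ := ih (q := applyMove q m) (a := a) hp ho' hz' (by
        intro w hw
        have := hpq w hw
        simp only [applyMove]; split_ifs <;> omega) (by
        simp only [applyMove]; split_ifs with h5
        · subst h5; omega
        · omega
        · omega)
      refine ⟨m :: τ, ?_, ⟨hadj, h2.trans (hpq _ hs), t2⟩, ?_⟩
      · intro m' hm'
        rcases List.mem_cons.1 hm' with rfl | h'
        · exact ⟨hs, h⟩
        · exact t1 m' h'
      · have : applyMove p m x = p x := by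
          simp only [applyMove, if_neg hs.symm, if_neg (Ne.symm h)]
        rw [applySeq_cons, applySeq_cons]
        rw [this] at t3
        exact t3

theorem no_in {x : V} {σ : List (PMove V)} {p : V → ℕ}
    (hi : ∀ m ∈ σ, m.tgt ≠ x) : applySeq p σ x ≤ p x := by
  induction σ generalizing p with
  | nil => exact le_rfl
  | cons m σ ih =>
    rw [applySeq_cons]
    refine (ih (fun m' hm' => hi m' (by simp [hm']))).trans ?_
    have := hi m (by simp)
    simp only [applyMove, if_neg this.symm]
    split_ifs <;> omega

theorem exec_adj {σ : List (PMove V)} {p : V → ℕ} (hp : Executable G p σ) :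
    ∀ m ∈ σ, G.Adj m.src m.tgt := by
  induction σ generalizing p with
  | nil => simp
  | cons m σ ih =>
    intro m' hm'
    rcases List.mem_cons.1 hm' with rfl | h
    · exact hp.1
    · exact ih hp.2.2 m' h

theorem push {x y : V} (h : G.Adj x y) (j : ℕ) {p : V → ℕ} (hp : 2 * j ≤ p x) :
    ∃ τ, Executable G p τ ∧ applySeq p τ y = p y + j := by
  induction j generalizing p with
  | zero => exact ⟨[], trivial, by simp [applySeq_nil]⟩
  | succ j ih =>
    obtain ⟨τ, e, f⟩ := ih (p := applyMove p ⟨x, y⟩) (by simp [applyMove]; omega)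
    refine ⟨⟨x, y⟩ :: τ, ⟨h, by simp only; omega, e⟩, ?_⟩
    rw [applySeq_cons, f]
    simp only [applyMove, if_neg h.ne.symm, if_true]
    omega

theorem kreach_push {x y : V} (h : G.Adj x y) {p : V → ℕ} {σ : List (PMove V)}
    (e : Executable G p σ) {a n : ℕ} (hy : a ≤ applySeq p σ y) (hx : n ≤ applySeq p σ x) :
    KReachable G p (a + n / 2) y := by
  obtain ⟨τ, e', f⟩ := push h (n / 2) (p := applySeq p σ) (by omega)
  refine ⟨σ ++ τ, exec_append.2 ⟨e, e'⟩, ?_⟩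
  rw [applySeq_append, f]; omega

theorem kreach_half {x y : V} (h : G.Adj x y) {p : V → ℕ} {n : ℕ} (hx : KReachable G p n x) :
    KReachable G p (n / 2) y := by
  obtain ⟨σ, e, f⟩ := hx
  simpa using kreach_push h e (Nat.zero_le _) f

theorem kreach_add {p q : V → ℕ} {a b : ℕ} {x : V} (hp : KReachable G p a x)
    (hq : KReachable G q b x) : KReachable G (p + q) (a + b) x := by
  obtain ⟨σ, e, f⟩ := hp
  obtain ⟨τ, e', f'⟩ := hq
  have e1 : Executable G (p + q) σ := exec_mono (fun w => by simp) e
  have h1 : ∀ w, applySeq (p + q) σ w = applySeq p σ w + q w := by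
    intro w
    have := diff e e1 w
    simp only [Pi.add_apply] at this
    omega
  have e2 : Executable G (applySeq (p + q) σ) τ := exec_mono (fun w => by rw [h1]; omega) e'
  refine ⟨σ ++ τ, exec_append.2 ⟨e1, e2⟩, ?_⟩
  rw [applySeq_append]
  have := diff e' e2 x
  rw [h1] at this
  omega

theorem kreach_zero (p : V → ℕ) (x : V) : KReachable G p 0 x := ⟨[], trivial, Nat.zero_le _⟩

theorem kreach_sum {ι : Type*} (s : Finset ι) (U : ι → V → ℕ) (r : ι → ℕ) (x : V)
    (h : ∀ i ∈ s, KReachable G (U i) (r i) x) :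
    KReachable G (∑ i ∈ s, U i) (∑ i ∈ s, r i) x := by
  classical
  induction s using Finset.induction_on with
  | empty => exact kreach_zero _ _
  | insert i s hi ih =>
    rw [Finset.sum_insert hi, Finset.sum_insert hi]
    exact kreach_add (h i (by simp)) (ih fun j hj => h j (by simp [hj]))

theorem kreach_mono {p : V → ℕ} {a b : ℕ} {x : V} (hab : a ≤ b) (h : KReachable G p b x) :
    KReachable G p a x := by
  obtain ⟨σ, e, f⟩ := h
  exact ⟨σ, e, hab.trans f⟩

/-- Full source set. -/
def Src (G : SimpleGraph V) (p : V → ℕ) (x : V) (n : ℕ) : Set V :=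
  {y | ∃ σ, Executable G p σ ∧ (∀ m ∈ σ, m.src ≠ x) ∧ n ≤ applySeq p σ x ∧ (⟨y, x⟩ : PMove V) ∈ σ}

theorem src_adj {p : V → ℕ} {x y : V} {n : ℕ} (h : y ∈ Src G p x n) : G.Adj y x := by
  obtain ⟨σ, e, -, -, hm⟩ := h
  exact exec_adj e _ hm

theorem src_k {p : V → ℕ} {x y : V} {n : ℕ} (h : y ∈ Src G p x n) :
    KReachable G p (2 + (n - 1) / 2) y := by
  have ha := src_adj h
  obtain ⟨σ, e, ho, hf, hm⟩ := h
  obtain ⟨τ, -, e', f1, f2⟩ := remove_one e ho hm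
  exact kreach_push ha.symm e' f1 (by omega)

theorem src_mono {p : V → ℕ} {x : V} {n n' : ℕ} (hn : n ≤ n') : Src G p x n' ⊆ Src G p x n := by
  rintro y ⟨σ, e, ho, hf, hm⟩
  exact ⟨σ, e, ho, hn.trans hf, hm⟩

theorem exists_in {p : V → ℕ} {x : V} {n : ℕ} {σ : List (PMove V)} (hn : p x < n)
    (hf : n ≤ applySeq p σ x) : ∃ y, (⟨y, x⟩ : PMove V) ∈ σ := by
  by_contra hcon
  push Not at hcon
  have := no_in (p := p) (x := x) (σ := σ) (fun m hm h => hcon m.src (by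
    have : m = ⟨m.src, x⟩ := by cases m; simp_all
    rwa [← this]))
  omega

theorem src_ne {p : V → ℕ} {x : V} {n : ℕ} (hn : p x < n) (h : KReachable G p n x) :
    (Src G p x n).Nonempty := by
  obtain ⟨σ, e, f⟩ := h
  obtain ⟨τ, -, e', ho, f'⟩ := nc x e
  obtain ⟨y, hy⟩ := exists_in hn (f.trans f')
  exact ⟨y, τ, e', ho, f.trans f', hy⟩

theorem single_aux {p : V → ℕ} {x z : V} {n : ℕ} {σ : List (PMove V)} (hn : p x < n)
    (e : Executable G p σ) (ho : ∀ m ∈ σ, m.src ≠ x) (f : n ≤ applySeq p σ x)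
    (hz : ∀ y, (⟨y, x⟩ : PMove V) ∈ σ → y = z) :
    ∃ τ : List (PMove V), (∀ m ∈ τ, m.src ≠ x ∧ m.tgt ≠ x) ∧ Executable G p τ ∧
      2 * (n - p x) ≤ applySeq p τ z := by
  obtain ⟨y, hy⟩ := exists_in hn f
  have hzx : z ≠ x := by
    have := (exec_adj e _ hy).ne
    rw [hz y hy] at this
    exact this
  obtain ⟨τ, t1, t2, t3⟩ := remove_all (q := p) (a := 0) e ho (fun m hm h => hz m.src (by
    have : m = ⟨m.src, x⟩ := by cases m; simp_all
    rwa [← this])) hzx (fun _ _ => le_rfl) (by omega)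
  exact ⟨τ, t1, t2, by omega⟩

theorem src_single {p : V → ℕ} {x z : V} {n : ℕ} (hn : p x < n) (h : KReachable G p n x)
    (hz : ∀ y ∈ Src G p x n, y = z) : KReachable G p (2 * (n - p x)) z := by
  obtain ⟨σ, e, f⟩ := h
  obtain ⟨τ, -, e', ho, f'⟩ := nc x e
  obtain ⟨τ, -, t2, t3⟩ := single_aux hn e' ho (f.trans f') (fun y hy =>
    hz y ⟨τ, e', ho, f.trans f', hy⟩)
  exact ⟨τ, t2, t3⟩

/-- Minimal number of moves needed to get two pebbles. -/
noncomputable def rk (G : SimpleGraph V) (p : V → ℕ) (x : V) : ℕ :=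
  sInf {l | ∃ σ, Executable G p σ ∧ 2 ≤ applySeq p σ x ∧ σ.length = l}

theorem exists_min {p : V → ℕ} {x : V} (h : KReachable G p 2 x) :
    ∃ σ, Executable G p σ ∧ (∀ m ∈ σ, m.src ≠ x) ∧ 2 ≤ applySeq p σ x ∧ σ.length ≤ rk G p x := by
  obtain ⟨σ, e, f⟩ := h
  have hne : {l | ∃ σ, Executable G p σ ∧ 2 ≤ applySeq p σ x ∧ σ.length = l}.Nonempty :=
    ⟨_, σ, e, f, rfl⟩
  obtain ⟨σ', e', f', l'⟩ := Nat.sInf_mem hne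
  obtain ⟨τ, s, e2, ho, f2⟩ := nc x e'
  exact ⟨τ, e2, ho, f'.trans f2, s.length_le.trans l'.le⟩

/-- Minimal source sets. -/
theorem exists_M {p : V → ℕ} {x : V} (hx : p x < 2) (h : KReachable G p 2 x) :
    ∃ M : Set V, M.Nonempty ∧ M ⊆ Src G p x 2 ∧ (∀ y ∈ M, rk G p y < rk G p x) ∧
      (∀ z, (∀ y ∈ M, y = z) → KReachable G p (2 * (2 - p x)) z) ∧
      (p x = 0 → ∀ z, (∀ y ∈ M, y = z) → p z < 4 → ∃ y ∈ Src G p z 4, y ≠ x) := by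
  obtain ⟨σ, e, ho, f, l⟩ := exists_min h
  refine ⟨{y | (⟨y, x⟩ : PMove V) ∈ σ}, exists_in hx f, fun y hy => ⟨σ, e, ho, f, hy⟩, ?_, ?_, ?_⟩
  · intro y hy
    obtain ⟨τ, l', e', f1, f2⟩ := remove_one e ho hy
    have : rk G p y ≤ τ.length := Nat.sInf_le ⟨τ, e', f1, rfl⟩
    omega
  · intro z hz
    obtain ⟨τ, -, t2, t3⟩ := single_aux hx e ho f hz
    exact ⟨τ, t2, t3⟩
  · intro h0 z hz hp4
    obtain ⟨τ, t1, t2, t3⟩ := single_aux hx e ho f hz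
    obtain ⟨τ', s, e', ho', f'⟩ := nc z t2
    have h4 : 4 ≤ applySeq p τ' z := by rw [h0] at t3; omega
    obtain ⟨y, hy⟩ := exists_in hp4 h4
    exact ⟨y, ⟨τ', e', ho', h4, hy⟩, (t1 _ (s.subset hy)).1⟩

/-! Weights -/

section weight
variable [Fintype V]

/-- The weight of a distribution at `x`. -/
noncomputable def wt (G : SimpleGraph V) (p : V → ℕ) (x : V) : ℚ :=
  ∑ w, (p w : ℚ) * (1 / 2) ^ G.dist w x

theorem wt_move (hc : G.Connected) {p : V → ℕ} {m : PMove V} (ha : G.Adj m.src m.tgt)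
    (h2 : 2 ≤ p m.src) (x : V) : wt G (applyMove p m) x ≤ wt G p x := by
  have key : wt G (applyMove p m) x + 2 * (1 / 2) ^ G.dist m.src x
      = wt G p x + (1 / 2) ^ G.dist m.tgt x := by
    have h : ∀ w, ((applyMove p m w : ℕ) : ℚ) * (1 / 2) ^ G.dist w x
        + (if w = m.src then 2 * (1 / 2) ^ G.dist m.src x else 0)
        = (p w : ℚ) * (1 / 2) ^ G.dist w x + (if w = m.tgt then (1 / 2) ^ G.dist m.tgt x else 0) := by
      intro w
      by_cases h1 : w = m.src
      · subst h1
        rw [if_pos rfl, if_neg ha.ne]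
        simp only [applyMove, if_true]
        push_cast [h2]
        ring
      · by_cases h3 : w = m.tgt
        · rw [if_neg h1, if_pos h3]
          simp only [applyMove, if_neg h1, if_pos h3]
          push_cast
          rw [h3]; ring
        · rw [if_neg h1, if_neg h3]
          simp only [applyMove, if_neg h1, if_neg h3]
    have := Finset.sum_congr (rfl : (Finset.univ : Finset V) = Finset.univ) (fun w _ => h w)
    simpa [Finset.sum_add_distrib, wt] using this
  have hd : G.dist m.src x ≤ G.dist m.tgt x + 1 := by
    have := hc.dist_triangle (u := m.src) (v := m.tgt) (w := x)
    rw [SimpleGraph.dist_eq_one_iff_adj.2 ha] at this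
    omega
  have : ((1 : ℚ) / 2) ^ (G.dist m.tgt x + 1) ≤ (1 / 2) ^ G.dist m.src x :=
    pow_le_pow_of_le_one (by norm_num) (by norm_num) hd
  rw [pow_succ] at this
  linarith

theorem wt_seq (hc : G.Connected) {σ : List (PMove V)} {p : V → ℕ} (e : Executable G p σ) (x : V) :
    (applySeq p σ x : ℚ) ≤ wt G p x := by
  induction σ generalizing p with
  | nil =>
    rw [applySeq_nil, wt]
    have := Finset.single_le_sum (f := fun w => (p w : ℚ) * (1 / 2) ^ G.dist w x)
      (fun w _ => by positivity) (Finset.mem_univ x)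
    simpa using this
  | cons m σ ih => exact (ih e.2.2).trans (wt_move hc e.1 e.2.1 x)

theorem kreach_le (hc : G.Connected) {p : V → ℕ} {n : ℕ} {x : V} (h : KReachable G p n x) :
    (n : ℚ) ≤ wt G p x := by
  obtain ⟨σ, e, f⟩ := h
  exact le_trans (by exact_mod_cast f) (wt_seq hc e x)

theorem bdd (hc : G.Connected) (p : V → ℕ) (x : V) : BddAbove {k | KReachable G p k x} := by
  refine ⟨⌊wt G p x⌋₊, fun n hn => Nat.le_floor (kreach_le hc hn)⟩

theorem kreach_iff (hc : G.Connected) {p : V → ℕ} {n : ℕ} {x : V} :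
    KReachable G p n x ↔ n ≤ reach G p x := by
  constructor
  · exact fun h => le_csSup (bdd hc p x) h
  · intro h
    have : reach G p x ∈ {k | KReachable G p k x} := Nat.sSup_mem ⟨0, kreach_zero p x⟩ (bdd hc p x)
    exact kreach_mono h this

theorem reach_le_wt (hc : G.Connected) (p : V → ℕ) (x : V) : (reach G p x : ℚ) ≤ wt G p x :=
  kreach_le hc ((kreach_iff hc).2 le_rfl)

theorem unit_ge (hc : G.Connected) (a : ℕ) (u : V) (d : ℕ) :
    ∀ x, G.dist u x = d → KReachable G (fun w => if w = u then a else 0) (a / 2 ^ d) x := by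
  induction d with
  | zero =>
    intro x hx
    have : u = x := hc.dist_eq_zero_iff.1 hx
    subst this
    exact ⟨[], trivial, by simp [applySeq_nil]⟩
  | succ d ih =>
    intro x hx
    obtain ⟨y, hy, hxy⟩ : ∃ y, G.dist u y = d ∧ G.Adj y x := by
      obtain ⟨W, hW⟩ := hc.exists_walk_length_eq_dist x u
      cases W with
      | nil => rw [SimpleGraph.dist_self] at hx; omega
      | @cons _ y _ h W =>
        refine ⟨y, ?_, h.symm⟩
        have h1 : G.dist u y ≤ W.length := by rw [SimpleGraph.dist_comm]; exact SimpleGraph.dist_le W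
        have h2 := hc.dist_triangle (u := u) (v := y) (w := x)
        rw [SimpleGraph.dist_eq_one_iff_adj.2 h.symm] at h2
        rw [SimpleGraph.dist_comm, hx] at hW
        simp at hW
        omega
    have := kreach_half hxy (ih y hy)
    rwa [Nat.div_div_eq_div_mul, ← pow_succ] at this

theorem unit_reach (hc : G.Connected) (a : ℕ) (u x : V) :
    reach G (fun w => if w = u then a else 0) x = a / 2 ^ G.dist u x := by
  apply le_antisymm
  · have := reach_le_wt hc (fun w => if w = u then a else 0) x
    rw [wt] at this
    rw [Nat.le_div_iff_mul_le (by positivity)]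
    simp only [Nat.cast_ite, Nat.cast_zero, ite_mul, zero_mul, Finset.sum_ite_eq', Finset.mem_univ,
      if_true] at this
    rw [one_div, inv_pow, ← div_eq_mul_inv, le_div_iff₀ (by positivity)] at this
    exact_mod_cast this
  · exact (kreach_iff hc).1 (unit_ge hc a u _ x rfl)

end weight

end Peb

namespace Peb

/-- Abstract data for the discharging argument. -/
structure Ctx (V : Type*) [Fintype V] [DecidableEq V] (G : SimpleGraph V) [DecidableRel G.Adj]
    (ι : Type*) [Fintype ι] where
  P : V → ℕ
  k : V → ℕ
  u : ι → V
  r : ι → V → ℕ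
  ds : ι → V → ℕ
  S : V → ℕ → Set V
  M : V → Set V
  rk : V → ℕ
  D : ℕ
  hD : 1 ≤ D
  deg : ∀ x, G.degree x ≤ D + 2
  k1 : ∀ x, 1 ≤ k x
  kR : ∀ x, ∑ i, r i x ≤ k x
  nb : ∀ i x y, G.Adj x y → r i x ≤ 2 * r i y + 1
  pred : ∀ i x, 1 ≤ r i x → x ≠ u i → ∃ z, G.Adj x z ∧ ds i z < ds i x ∧ 2 * r i x ≤ r i z
  pr : ∀ i, P (u i) = r i (u i)
  ru : ∀ i, 1 ≤ r i (u i)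
  rle : ∀ i x, x ≠ u i → 2 * r i x ≤ r i (u i)
  pz : ∀ x, (∀ i, x ≠ u i) → P x = 0
  uinj : ∀ i j, u i = u j → i = j
  S_adj : ∀ x y n, y ∈ S x n → G.Adj y x
  S_k : ∀ x y n, y ∈ S x n → 2 + (n - 1) / 2 ≤ k y
  S_mono : ∀ x n n', n ≤ n' → S x n' ⊆ S x n
  S_ne : ∀ x n, P x < n → n ≤ k x → (S x n).Nonempty
  S_one : ∀ x n z, P x < n → n ≤ k x → (∀ y ∈ S x n, y = z) → 2 * (n - P x) ≤ k z
  M_ne : ∀ x, P x < 2 → 2 ≤ k x → (M x).Nonempty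
  M_sub : ∀ x, P x < 2 → 2 ≤ k x → M x ⊆ S x 2
  M_rk : ∀ x, P x < 2 → 2 ≤ k x → ∀ y ∈ M x, rk y < rk x
  M_one : ∀ x, P x < 2 → 2 ≤ k x → ∀ z, (∀ y ∈ M x, y = z) → 2 * (2 - P x) ≤ k z
  M_src : ∀ x, P x < 2 → 2 ≤ k x → P x = 0 → ∀ z, (∀ y ∈ M x, y = z) → P z < 4 →
    ∃ y ∈ S z 4, y ≠ x

namespace Ctx

variable {V : Type*} [Fintype V] [DecidableEq V] {G : SimpleGraph V} [DecidableRel G.Adj]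
  {ι : Type*} [Fintype ι] (C : Ctx V G ι)

/-- Total reach of units. -/
def R (x : V) : ℕ := ∑ i, C.r i x

/-- Number of units covering `x`. -/
def c (x : V) : ℕ := (Finset.univ.filter fun i => 1 ≤ C.r i x).card

/-- The cooperation excess at `x`, shifted. -/
def E (x : V) : ℕ := C.k x + C.c x - 1 - C.R x

theorem r_le (i : ι) (x : V) : C.r i x ≤ C.R x :=
  Finset.single_le_sum (f := fun i => C.r i x) (fun _ _ => Nat.zero_le _) (Finset.mem_univ i)

theorem c_eq (x : V) : C.c x = ∑ i, if 1 ≤ C.r i x then 1 else 0 := by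
  rw [c, Finset.card_filter]

theorem c_le (x : V) : C.c x ≤ C.R x := by
  rw [c_eq, R]
  exact Finset.sum_le_sum fun i _ => by split_ifs <;> omega

theorem hE (x : V) : C.E x + 1 + C.R x = C.k x + C.c x := by
  have := C.kR x
  have h1 := C.k1 x
  have h2 := C.c_le x
  have : C.R x ≤ C.k x := this
  have : C.R x = 0 ∨ 1 ≤ C.c x := by
    by_contra h
    push Not at h
    apply h.1
    rw [R, Finset.sum_eq_zero_iff]
    intro i _
    by_contra hi
    have : 0 < C.c x := Finset.card_pos.2 ⟨i, by simp; omega⟩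
    omega
  unfold E
  omega

theorem c_pos {i : ι} {x : V} (h : 1 ≤ C.r i x) : 1 ≤ C.c x :=
  Finset.card_pos.2 ⟨i, by simpa using h⟩

theorem one {i : ι} {x : V} (hc : C.c x = 1) (h : 1 ≤ C.r i x) :
    C.R x = C.r i x ∧ ∀ j, 1 ≤ C.r j x → j = i := by
  obtain ⟨a, ha⟩ := Finset.card_eq_one.1 hc
  have key : ∀ j, 1 ≤ C.r j x → j = a := fun j hj => by
    have : j ∈ Finset.univ.filter fun i => 1 ≤ C.r i x := by simpa using hj
    rw [ha] at this
    simpa using this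
  have hi := key i h
  subst hi
  refine ⟨?_, key⟩
  rw [R]
  exact Finset.sum_eq_single i (fun j _ hj => by by_contra h0; exact hj (key j (by omega)))
    (by simp)

theorem cls (x : V) : (C.c x = 0 ∧ C.R x = 0) ∨ (∃ i, C.c x = 1 ∧ 1 ≤ C.r i x) ∨ 2 ≤ C.c x := by
  rcases Nat.lt_or_ge 1 (C.c x) with h | h
  · exact Or.inr (Or.inr h)
  · rcases Nat.eq_zero_or_pos (C.c x) with h0 | h0
    · left
      refine ⟨h0, ?_⟩
      rw [R, Finset.sum_eq_zero_iff]
      intro i _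
      by_contra hi
      have := C.c_pos (i := i) (x := x) (by omega)
      omega
    · right; left
      obtain ⟨i, hi⟩ := Finset.card_pos.1 h0
      exact ⟨i, by omega, by simpa using hi⟩

theorem two {x : V} (h : 2 ≤ C.c x) : ∃ i, 1 ≤ C.r i x ∧ x ≠ C.u i := by
  obtain ⟨i, hi, j, hj, hij⟩ := Finset.one_lt_card.1 h
  by_cases hx : x = C.u i
  · exact ⟨j, by simpa using hj, fun hx' => hij (C.uinj i j (hx ▸ hx'))⟩
  · exact ⟨i, by simpa using hi, hx⟩

theorem small {x : V} (h : ∀ i, C.r i x ≤ 1) : C.R x = C.c x := by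
  rw [c_eq, R]
  exact Finset.sum_congr rfl fun i _ => by have := h i; split_ifs <;> omega

theorem almost {x : V} {i : ι} (hi : 1 ≤ C.r i x) (h : ∀ j, j ≠ i → C.r j x ≤ 1) :
    C.R x + 1 ≤ C.r i x + C.c x := by
  classical
  rw [c_eq, R, ← Finset.add_sum_erase _ _ (Finset.mem_univ i),
    ← Finset.add_sum_erase _ _ (Finset.mem_univ i), if_pos hi]
  have : ∑ j ∈ Finset.univ.erase i, C.r j x
      ≤ ∑ j ∈ Finset.univ.erase i, if 1 ≤ C.r j x then 1 else 0 :=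
    Finset.sum_le_sum fun j hj => by
      have := h j (Finset.ne_of_mem_erase hj); split_ifs <;> omega
  omega

theorem Pcase (x : V) : C.P x = 0 ∨ ∃ i, x = C.u i ∧ C.P x = C.r i x ∧ 1 ≤ C.r i x := by
  by_cases h : ∃ i, x = C.u i
  · obtain ⟨i, rfl⟩ := h
    exact Or.inr ⟨i, rfl, C.pr i, C.ru i⟩
  · push Not at h
    exact Or.inl (C.pz x h)

theorem P_le (x : V) : C.P x ≤ C.R x := by
  rcases C.Pcase x with h | ⟨i, -, h, -⟩
  · omega
  · rw [h]; exact C.r_le i x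

open Classical in
/-- Extra demand. -/
noncomputable def ext (x z : V) : ℕ :=
  if (C.k x = 2 ∧ ∀ y ∈ C.M x, y = z) ∨ (C.k x = 4 ∧ 6 ≤ C.k z) then 1 else 0

theorem ext_le (x z : V) : C.ext x z ≤ 1 := by unfold ext; split_ifs <;> omega

theorem ext_pos {x z : V} (h : 1 ≤ C.ext x z) :
    (C.k x = 2 ∧ ∀ y ∈ C.M x, y = z) ∨ (C.k x = 4 ∧ 6 ≤ C.k z) := by
  unfold ext at h
  split_ifs at h with h'
  · exact h'
  · omega

theorem ext_zero {x z : V} (h : C.ext x z = 0) :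
    ¬ ((C.k x = 2 ∧ ∀ y ∈ C.M x, y = z) ∨ (C.k x = 4 ∧ 6 ≤ C.k z)) := by
  unfold ext at h
  split_ifs at h with h'
  exact h'

/-- `x` demands `e` from `z`. -/
def Spec (x z : V) (e : ℕ) : Prop :=
  (C.R x = 0 ∧ C.k x = 1 ∧ z ∈ C.S x 1 ∧ e = 1) ∨
  (C.R x ≤ 1 ∧ 2 ≤ C.k x ∧ z ∈ C.M x ∧ e + C.R x = 1 + C.ext x z) ∨
  (e = 0 ∧ C.R x = 1 ∧ C.k x = 1) ∨
  (∃ i, C.c x = 1 ∧ 2 ≤ C.r i x ∧ x ≠ C.u i ∧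
    ((e = 1 ∧ C.k x = C.r i x + 1 ∧ G.Adj x z ∧ C.ds i z < C.ds i x ∧ 2 * C.r i x ≤ C.r i z ∧
        2 * (C.r i x + 1) ≤ C.k z) ∨
     (e = 0 ∧ (C.k x = C.r i x + 1 → ∀ z, G.Adj x z → C.ds i z < C.ds i x →
        2 * C.r i x ≤ C.r i z → C.k z < 2 * (C.r i x + 1))))) ∨
  (∃ i, C.c x = 1 ∧ 2 ≤ C.r i x ∧ x = C.u i ∧
    ((e = 1 ∧ C.k x = C.r i x + 1 ∧ ∀ y ∈ C.S x (C.r i x + 1), y = z) ∨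
     (e = 0 ∧ (C.k x = C.r i x + 1 → ∀ z, ∃ y ∈ C.S x (C.r i x + 1), y ≠ z)))) ∨
  (2 ≤ C.c x ∧ e = 0)

theorem exists_spec (x : V) : ∃ z e, C.Spec x z e := by
  have hk := C.k1 x
  have hP := C.P_le x
  by_cases hR : C.R x ≤ 1
  · by_cases h2 : 2 ≤ C.k x
    · obtain ⟨z, hz⟩ := C.M_ne x (by omega) h2
      exact ⟨z, 1 + C.ext x z - C.R x, Or.inr (Or.inl ⟨hR, h2, hz, by omega⟩)⟩
    · by_cases h0 : C.R x = 0
      · obtain ⟨z, hz⟩ := C.S_ne x 1 (by omega) hk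
        exact ⟨z, 1, Or.inl ⟨h0, by omega, hz, rfl⟩⟩
      · exact ⟨x, 0, Or.inr (Or.inr (Or.inl ⟨rfl, by omega, by omega⟩))⟩
  · rcases C.cls x with h | ⟨i, hc, hi⟩ | h
    · omega
    · have h1 := (C.one hc hi).1
      by_cases hx : x = C.u i
      · by_cases hcon : C.k x = C.r i x + 1 ∧ ∃ z, ∀ y ∈ C.S x (C.r i x + 1), y = z
        · obtain ⟨h3, z, hz⟩ := hcon
          exact ⟨z, 1, Or.inr (Or.inr (Or.inr (Or.inr (Or.inl
            ⟨i, hc, by omega, hx, Or.inl ⟨rfl, h3, hz⟩⟩))))⟩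
        · refine ⟨x, 0, Or.inr (Or.inr (Or.inr (Or.inr (Or.inl
            ⟨i, hc, by omega, hx, Or.inr ⟨rfl, ?_⟩⟩))))⟩
          intro h3 z
          by_contra h4
          push Not at h4
          exact hcon ⟨h3, z, h4⟩
      · by_cases hcon : C.k x = C.r i x + 1 ∧ ∃ z, G.Adj x z ∧ C.ds i z < C.ds i x ∧
          2 * C.r i x ≤ C.r i z ∧ 2 * (C.r i x + 1) ≤ C.k z
        · obtain ⟨h3, z, hz⟩ := hcon
          exact ⟨z, 1, Or.inr (Or.inr (Or.inr (Or.inl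
            ⟨i, hc, by omega, hx, Or.inl ⟨rfl, h3, hz⟩⟩)))⟩
        · refine ⟨x, 0, Or.inr (Or.inr (Or.inr (Or.inl
            ⟨i, hc, by omega, hx, Or.inr ⟨rfl, ?_⟩⟩)))⟩
          intro h3 z a b d
          by_contra h4
          exact hcon ⟨h3, z, a, b, d, by omega⟩
    · exact ⟨x, 0, Or.inr (Or.inr (Or.inr (Or.inr (Or.inr ⟨h, rfl⟩))))⟩

variable {C}

/-- Case analysis for a positive demand. -/
theorem dem {x y : V} {e : ℕ} (h : C.Spec y x e) (he : 1 ≤ e) :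
    (C.R y = 0 ∧ C.k y = 1 ∧ x ∈ C.S y 1 ∧ e = 1) ∨
    (C.R y ≤ 1 ∧ C.P y ≤ C.R y ∧ 2 ≤ C.k y ∧ x ∈ C.M y ∧ e + C.R y = 1 + C.ext y x) ∨
    (∃ i, C.c y = 1 ∧ C.R y = C.r i y ∧ 2 ≤ C.r i y ∧ y ≠ C.u i ∧ e = 1 ∧ C.k y = C.r i y + 1 ∧
      G.Adj y x ∧ C.ds i x < C.ds i y ∧ 2 * C.r i y ≤ C.r i x ∧ 2 * (C.r i y + 1) ≤ C.k x ∧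
      ∀ j, 1 ≤ C.r j y → j = i) ∨
    (∃ i, C.c y = 1 ∧ C.R y = C.r i y ∧ 2 ≤ C.r i y ∧ y = C.u i ∧ e = 1 ∧ C.k y = C.r i y + 1 ∧
      (∀ w ∈ C.S y (C.r i y + 1), w = x) ∧ x ∈ C.S y (C.r i y + 1) ∧
      ∀ j, 1 ≤ C.r j y → j = i) := by
  rcases h with h | ⟨a, b, c, d⟩ | h | ⟨i, a, b, c, d | d⟩ | ⟨i, a, b, c, d | d⟩ | h
  · exact Or.inl h
  · exact Or.inr (Or.inl ⟨a, C.P_le y, b, c, d⟩)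
  · omega
  · obtain ⟨h1, h2⟩ := C.one a (i := i) (by omega)
    obtain ⟨d1, d2, d3, d4, d5, d6⟩ := d
    exact Or.inr (Or.inr (Or.inl ⟨i, a, h1, b, c, d1, d2, d3, d4, d5, d6, h2⟩))
  · omega
  · obtain ⟨h1, h2⟩ := C.one a (i := i) (by omega)
    obtain ⟨d1, d2, d3⟩ := d
    obtain ⟨w, hw⟩ := C.S_ne y (C.r i y + 1) (by have := C.pr i; rw [← c] at this; omega) d2.ge
    have := d3 w hw
    subst this
    exact Or.inr (Or.inr (Or.inr ⟨i, a, h1, b, c, d1, d2, d3, hw, h2⟩))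
  · omega
  · omega

theorem dem_adj {x y : V} {e : ℕ} (h : C.Spec y x e) (he : 1 ≤ e) : G.Adj x y := by
  rcases dem h he with ⟨_, _, h, _⟩ | ⟨_, _, _, h, _⟩ | ⟨i, _, _, _, _, _, _, h, _⟩ |
    ⟨i, _, _, _, _, _, _, _, h, _⟩
  · exact C.S_adj _ _ _ h
  · exact C.S_adj _ _ _ (C.M_sub _ (by omega) (by omega) h)
  · exact h.symm
  · exact C.S_adj _ _ _ h

theorem dem_k {x y : V} {e : ℕ} (h : C.Spec y x e) (he : 1 ≤ e) : 2 ≤ C.k x := by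
  rcases dem h he with ⟨_, _, h, _⟩ | ⟨_, _, _, h, _⟩ | ⟨i, _, _, _, _, _, _, _, _, _, _, _⟩ |
    ⟨i, _, _, _, _, _, _, _, h, _⟩
  · have := C.S_k _ _ _ h; omega
  · have := C.S_k _ _ _ (C.M_sub _ (by omega) (by omega) h); omega
  · omega
  · have := C.S_k _ _ _ h; omega

theorem dem_two {x y : V} {e : ℕ} (h : C.Spec y x e) : e ≤ 2 := by
  rcases Nat.eq_zero_or_pos e with he | he
  · omega
  have := C.ext_le y x
  rcases dem h he with ⟨_, _, h, _⟩ | ⟨_, _, _, h, _⟩ | ⟨i, _, _, _, _, _, _, _, _, _, _, _⟩ |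
    ⟨i, _, _, _, _, _, _, _, h, _⟩ <;> omega

theorem dem_two' {x y : V} {e : ℕ} (h : C.Spec y x e) (he : 2 ≤ e) :
    C.R y = 0 ∧ 4 ≤ C.k x ∧ (C.k y = 2 ∨ (C.k y = 4 ∧ 6 ≤ C.k x)) := by
  have := C.ext_le y x
  rcases dem h (by omega) with ⟨_, _, h, _⟩ | ⟨_, _, h2, h, _⟩ |
    ⟨i, _, _, _, _, _, _, _, _, _, _, _⟩ | ⟨i, _, _, _, _, _, _, _, h, _⟩
  · omega
  · have hR : C.R y = 0 := by omega
    refine ⟨hR, ?_⟩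
    rcases C.ext_pos (x := y) (z := x) (by omega) with ⟨h3, h4⟩ | ⟨h3, h4⟩
    · have := C.M_one y (by omega) h2 x h4
      omega
    · omega
  · omega
  · omega

theorem dem_R {x y : V} {e : ℕ} (h : C.Spec y x e) (hR : 1 ≤ C.R y) : e ≤ 1 := by
  by_contra hcon
  have := (dem_two' h (by omega)).1
  omega

theorem dem_big {x y : V} {e : ℕ} (h : C.Spec y x e) (hk : 3 ≤ C.k y) (hx : C.k x < 6) :
    e ≤ 1 := by
  by_contra hcon
  have := (dem_two' h (by omega)).2
  omega

theorem dem_pred {x y : V} {e : ℕ} {i : ι} (h : C.Spec y x e) (he : 1 ≤ e)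
    (hd : C.ds i y < C.ds i x) (hr : 2 ≤ C.r i y) :
    y = C.u i ∧ C.c y = 1 ∧ C.k y = C.r i y + 1 ∧ x ∈ C.S y (C.r i y + 1) := by
  have := C.r_le i y
  rcases dem h he with ⟨_, _, h, _⟩ | ⟨_, _, _, h, _⟩ | ⟨j, _, _, _, _, _, _, _, h1, _, _, h2⟩ |
    ⟨j, h1, h2, h3, h4, h5, h6, h7, h8, h9⟩
  · omega
  · omega
  · have := h2 i (by omega)
    subst this
    omega
  · have := h9 i (by omega)
    subst this
    exact ⟨h4, h1, h6, h8⟩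

/-! Sum bounds -/

theorem B1 {x : V} {f : V → ℕ} (hf : ∀ y, 1 ≤ f y → G.Adj x y) (B : ℕ) (hB : ∀ y, f y ≤ B) :
    ∑ y, f y ≤ B * (C.D + 2) := by
  have h1 : ∑ y, f y = ∑ y ∈ G.neighborFinset x, f y := by
    symm
    apply Finset.sum_subset (Finset.subset_univ _)
    intro y _ hy
    by_contra h
    exact hy ((G.mem_neighborFinset x y).2 (hf y (by omega)))
  rw [h1]
  calc _ ≤ (G.neighborFinset x).card • B := Finset.sum_le_card_nsmul _ _ _ (fun y _ => hB y)
    _ = B * G.degree x := by simp [mul_comm]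
    _ ≤ _ := Nat.mul_le_mul_left _ (C.deg x)

theorem upd {f : V → ℕ} (a : V) (B : ℕ) :
    ∑ y, Function.update f a B y + f a = ∑ y, f y + B := by
  rw [Finset.sum_update_of_mem (Finset.mem_univ a), ← Finset.add_sum_erase _ f (Finset.mem_univ a),
    Finset.sdiff_singleton_eq_erase]
  omega

theorem B2 {x : V} {f : V → ℕ} (hf : ∀ y, 1 ≤ f y → G.Adj x y) (B : ℕ) (hB : ∀ y, f y ≤ B)
    {a : V} (ha : G.Adj x a) {A : ℕ} (hA : f a ≤ A) :
    ∑ y, f y + B ≤ A + B * (C.D + 2) := by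
  have h1 := upd (f := f) a B
  have h2 := B1 (C := C) (x := x) (f := Function.update f a B) (fun y hy => by
    by_cases h : y = a
    · exact h ▸ ha
    · exact hf y (by simpa [Function.update_of_ne h] using hy)) B (fun y => by
    by_cases h : y = a
    · subst h; simp
    · simpa [Function.update_of_ne h] using hB y)
  omega

theorem B3 {x : V} {f : V → ℕ} (hf : ∀ y, 1 ≤ f y → G.Adj x y) (B : ℕ) (hB : ∀ y, f y ≤ B)
    {a : V} (ha : G.Adj x a) {A : ℕ} (hA : f a ≤ A)
    {b : V} (hb : G.Adj x b) {A' : ℕ} (hA' : f b ≤ A') (hab : b ≠ a) :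
    ∑ y, f y + 2 * B ≤ A + A' + B * (C.D + 2) := by
  have h1 := upd (f := f) a B
  have h2 := B2 (C := C) (x := x) (f := Function.update f a B) (fun y hy => by
    by_cases h : y = a
    · exact h ▸ ha
    · exact hf y (by simpa [Function.update_of_ne h] using hy)) B (fun y => by
    by_cases h : y = a
    · subst h; simp
    · simpa [Function.update_of_ne h] using hB y) hb (A := A') (by
    simpa [Function.update_of_ne hab] using hA')
  omega

end Ctx
end Peb

namespace Peb
namespace Ctx

variable {V : Type*} [Fintype V] [DecidableEq V] {G : SimpleGraph V} [DecidableRel G.Adj]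
  {ι : Type*} [Fintype ι] {C : Ctx V G ι}

theorem mem_M {x y : V} {e : ℕ} (hR : C.R x ≤ 1) (hk : 2 ≤ C.k x) (hy : y ∈ C.M x)
    (h : C.Spec y x e) (he : 1 ≤ e) : ∃ i, y = C.u i ∧ 2 ≤ C.r i y := by
  have hP := C.P_le x
  rcases dem h he with ⟨_, h1, h, _⟩ | ⟨h1, _, h2, h, _⟩ |
    ⟨j, _, _, _, _, _, _, _, h1, h2, _, _⟩ | ⟨j, h1, h2, h3, h4, h5, h6, h7, h8, h9⟩
  · have := C.S_k _ _ _ (C.M_sub x (by omega) hk hy)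
    omega
  · have h3 := C.M_rk x (by omega) hk y hy
    have h4 := C.M_rk y (by omega) h2 x h
    omega
  · have := C.r_le j x
    omega
  · exact ⟨j, h4, h3⟩

/-- Targets with `R ≤ 1`. -/
theorem T12 {x z : V} {dx : ℕ} (hR : C.R x ≤ 1) (hk : 2 ≤ C.k x) (hz : z ∈ C.M x)
    (hdx : dx + C.R x = 1 + C.ext x z) {f : V → ℕ} (hf : ∀ y, 1 ≤ f y → C.Spec y x (f y)) :
    ∑ y, f y + 1 ≤ C.D * C.E x + C.c x + dx := by
  have hP := C.P_le x
  have hD := C.hD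
  have hE := C.hE x
  have hcR : C.c x = C.R x := by
    rw [C.small]
    intro i
    exact (C.r_le i x).trans hR
  have hadj : ∀ y, 1 ≤ f y → G.Adj x y := fun y hy => dem_adj (hf y hy) hy
  have h2 : ∀ y, f y ≤ 2 := fun y => by
    rcases Nat.eq_zero_or_pos (f y) with h | h
    · omega
    · exact dem_two (hf y h)
  have h1 : C.k x < 4 → ∀ y, f y ≤ 1 := fun hk4 y => by
    by_contra h
    have := (dem_two' (hf y (by omega)) (by omega)).2.1
    omega
  have hMadj : ∀ y ∈ C.M x, G.Adj x y := fun y hy =>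
    (C.S_adj _ _ _ (C.M_sub x (by omega) hk hy)).symm
  by_cases hroot : ∃ y i, 1 ≤ f y ∧ y = C.u i ∧ 2 ≤ C.r i y
  · obtain ⟨y0, i, hy0, hyi, hri⟩ := hroot
    have hnb := C.nb i y0 x (hadj y0 hy0).symm
    have hle := C.r_le i x
    have hc1 : C.c x = 1 := by omega
    obtain ⟨hRi, huniq⟩ := C.one hc1 (i := i) (by omega)
    have hr0 := C.r_le i y0
    rcases dem (hf y0 hy0) hy0 with ⟨_, _, _, _⟩ | ⟨_, _, _, _, _⟩ |
      ⟨j, _, a1, a2, a3, a4, a5, a6, a7, a8, a9, a10⟩ |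
      ⟨j, a1, a2, a3, a4, a5, a6, a7, a8, a9⟩
    · omega
    · omega
    · have := a10 i (by omega)
      subst this
      exact absurd hyi a3
    · have := a9 i (by omega)
      subst this
      have hkx := C.S_k _ _ _ a8
      have hPx : C.P x = 0 := by
        rcases C.Pcase x with h | ⟨j, hj, _, hj1⟩
        · exact h
        · have := huniq j hj1
          subst this
          exact absurd (hj.trans hyi.symm) (hadj y0 hy0).ne
      have hPy : C.P y0 = C.r i y0 := by rw [hyi]; exact C.pr i
      obtain ⟨y, hy, hyy⟩ : ∃ y ∈ C.M x, y ≠ y0 := by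
        by_contra hcon
        push Not at hcon
        obtain ⟨w, hw, hwx⟩ := C.M_src x (by omega) hk hPx y0 hcon (by omega)
        exact hwx (a7 w (C.S_mono _ _ _ (by omega) hw))
      have hfy : f y ≤ 0 := by
        by_contra hcon
        obtain ⟨j, hj, hj2⟩ := mem_M hR hk hy (hf y (by omega)) (by omega)
        have := C.nb j y x (hMadj y hy).symm
        have := huniq j (by omega)
        subst this
        exact hyy (hj.trans hyi.symm)
      rcases Nat.lt_or_ge (C.k x) 4 with hk4 | hk4
      · have := B2 (C := C) hadj 1 (h1 hk4) (hMadj y hy) hfy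
        have : C.E x = 2 := by omega
        rw [this]
        omega
      · have := B3 (C := C) hadj 2 h2 (hadj y0 hy0) (A := 1) (by omega) (hMadj y hy) hfy hyy
        have : C.D * 3 ≤ C.D * C.E x := Nat.mul_le_mul_left _ (by omega)
        omega
  · have hM0 : ∀ y ∈ C.M x, f y ≤ 0 := by
      intro y hy
      by_contra hcon
      obtain ⟨i, hi⟩ := mem_M hR hk hy (hf y (by omega)) (by omega)
      exact hroot ⟨y, i, by omega, hi⟩
    have hz0 := hM0 z hz
    have hza := hMadj z hz
    have hext := C.ext_le x z
    rcases Nat.lt_or_ge (C.k x) 5 with hk5 | hk5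
    · have : C.k x = 2 ∨ C.k x = 3 ∨ C.k x = 4 := by omega
      rcases this with h | h | h
      · have hE1 : C.E x = 1 := by omega
        rw [hE1]
        have hb := B2 (C := C) hadj 1 (h1 (by omega)) hza hz0
        rcases Nat.eq_zero_or_pos (C.ext x z) with he | he
        · have := C.ext_zero he
          obtain ⟨y, hy, hyz⟩ : ∃ y ∈ C.M x, y ≠ z := by
            by_contra hcon
            push Not at hcon
            exact this (Or.inl ⟨h, hcon⟩)
          have := B3 (C := C) hadj 1 (h1 (by omega)) hza hz0 (hMadj y hy) (hM0 y hy) hyz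
          omega
        · omega
      · have hE1 : C.E x = 2 := by omega
        rw [hE1]
        have hb := B2 (C := C) hadj 1 (h1 (by omega)) hza hz0
        omega
      · have hE1 : C.E x = 3 := by omega
        rw [hE1]
        have hb := B2 (C := C) hadj 2 h2 hza hz0
        rcases Nat.eq_zero_or_pos (C.ext x z) with he | he
        · have := C.ext_zero he
          obtain ⟨y, hy, hyz⟩ : ∃ y ∈ C.S x 4, y ≠ z := by
            by_contra hcon
            push Not at hcon
            have h6 := C.S_one x 4 z (by omega) (by omega) hcon
            exact this (Or.inr ⟨h, by omega⟩)
          have hky := C.S_k _ _ _ hy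
          have hfy : f y ≤ 1 := by
            rcases Nat.eq_zero_or_pos (f y) with h0 | h0
            · omega
            · exact dem_big (hf y h0) (by omega) (by omega)
          have := B3 (C := C) hadj 2 h2 hza hz0 (C.S_adj _ _ _ hy).symm hfy hyz
          omega
        · omega
    · have hb := B2 (C := C) hadj 2 h2 hza hz0
      have : C.D * 4 ≤ C.D * C.E x := Nat.mul_le_mul_left _ (by omega)
      omega

theorem T3dem {x : V} {i : ι} (hc : C.c x = 1) (hr : 2 ≤ C.r i x)
    {y : V} {e : ℕ} (h : C.Spec y x e) (he : 1 ≤ e) :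
    e ≤ 1 ∧ C.R x + 1 ≤ C.k x ∧ (y = C.u i → C.R x + 2 ≤ C.k x) := by
  have hxy := dem_adj h he
  obtain ⟨hRx, huniq⟩ := C.one hc (i := i) (by omega)
  have hnb := C.nb i x y hxy
  have hle := C.r_le i y
  refine ⟨dem_R h (by omega), ?_⟩
  rcases dem h he with ⟨_, h1, _, _⟩ | ⟨a1, a2, a3, a4, a5⟩ |
    ⟨j, _, a1, a2, a3, a4, a5, a6, a7, a8, a9, a10⟩ | ⟨j, a1, a2, a3, a4, a5, a6, a7, a8, a9⟩
  · omega
  · have hri : C.r i y = 1 := by omega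
    have hcy : C.c y = 1 := by have := C.c_le y; have := C.c_pos (i := i) (x := y) hri.ge; omega
    have hyi : y ≠ C.u i := by
      intro hyi
      by_cases hx : x = C.u i
      · exact hxy.ne (hx.trans hyi.symm)
      · have := C.rle i x hx
        rw [← hyi] at this
        omega
    have hPy : C.P y = 0 := by
      rcases C.Pcase y with h | ⟨j, hj, _, hj1⟩
      · exact h
      · have := (C.one hcy hri.ge).2 j hj1
        subst this
        exact absurd hj hyi
    refine ⟨?_, fun h => absurd h hyi⟩
    rcases C.ext_pos (x := y) (z := x) (by omega) with ⟨h3, h4⟩ | ⟨h3, h4⟩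
    · have := C.M_one y (by omega) (by omega) x h4
      omega
    · omega
  · have := a10 i (by omega)
    subst this
    exact ⟨by omega, fun h => absurd h a3⟩
  · have := a9 i (by omega)
    subst this
    have hx : x ≠ C.u i := fun hx => hxy.ne (hx.trans a4.symm)
    have h1 := C.rle i x hx
    rw [← a4] at h1
    have := C.S_k _ _ _ a8
    omega

theorem srcnon {x : V} {i : ι} (hc : C.c x = 1) (hr : 2 ≤ C.r i x)
    {y : V} {e n : ℕ} (hy : y ∈ C.S x n) (hn : C.R x + 1 ≤ n)
    (hk : C.k x ≤ C.R x + 2) (hyi : y ≠ C.u i) (h : C.Spec y x e) : e ≤ 0 := by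
  by_contra he
  have hxy := C.S_adj _ _ _ hy
  have hky := C.S_k _ _ _ hy
  obtain ⟨hRx, huniq⟩ := C.one hc (i := i) (by omega)
  have hnb := C.nb i x y hxy.symm
  have hle := C.r_le i y
  rcases dem h (by omega) with ⟨_, h1, _, _⟩ | ⟨a1, a2, a3, a4, a5⟩ |
    ⟨j, _, a1, a2, a3, a4, a5, a6, a7, a8, a9, a10⟩ | ⟨j, a1, a2, a3, a4, a5, a6, a7, a8, a9⟩
  · omega
  · rcases C.ext_pos (x := y) (z := x) (by omega) with ⟨h3, h4⟩ | ⟨h3, h4⟩ <;> omega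
  · have := a10 i (by omega)
    subst this
    omega
  · have := a9 i (by omega)
    subst this
    exact hyi a4

/-- Targets covered by one unit, not the root. -/
theorem T3 {x : V} {i : ι} (hc : C.c x = 1) (hr : 2 ≤ C.r i x)
    (hx : x ≠ C.u i) {dx : ℕ} (hdx : dx = 1 ∨ (C.k x = C.r i x + 1 → ∀ z, G.Adj x z →
    C.ds i z < C.ds i x → 2 * C.r i x ≤ C.r i z → C.k z < 2 * (C.r i x + 1)))
    {f : V → ℕ} (hf : ∀ y, 1 ≤ f y → C.Spec y x (f y)) :
    ∑ y, f y + 1 ≤ C.D * C.E x + C.c x + dx := by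
  have hD := C.hD
  have hE := C.hE x
  obtain ⟨hRx, huniq⟩ := C.one hc (i := i) (by omega)
  have hadj : ∀ y, 1 ≤ f y → G.Adj x y := fun y hy => dem_adj (hf y hy) hy
  have h1 : ∀ y, f y ≤ 1 := fun y => by
    rcases Nat.eq_zero_or_pos (f y) with h | h
    · omega
    · exact (T3dem hc hr (hf y h) h).1
  have hPx : C.P x = 0 := by
    rcases C.Pcase x with h | ⟨j, hj, _, hj1⟩
    · exact h
    · have := huniq j hj1
      subst this
      exact absurd hj hx
  obtain ⟨z0, hz0a, hz0d, hz0r⟩ := C.pred i x (by omega) hx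
  have hpz : 1 ≤ f z0 → z0 = C.u i ∧ C.k z0 = C.r i z0 + 1 := fun h => by
    obtain ⟨a, b, c, d⟩ := dem_pred (hf z0 h) h hz0d (by omega)
    exact ⟨a, c⟩
  rcases Nat.lt_or_ge (C.E x) 3 with h3 | h3
  · have : C.E x = 0 ∨ C.E x = 1 ∨ C.E x = 2 := by omega
    rcases this with h | h | h
    · have hb := B1 (C := C) hadj 0 (fun y => by
        by_contra hcon
        have := (T3dem hc hr (hf y (by omega)) (by omega)).2.1
        omega)
      omega
    · have hu : f (C.u i) ≤ 0 := by
        by_contra hcon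
        have := (T3dem hc hr (hf _ (by omega)) (by omega)).2.2 rfl
        omega
      have hfz : f z0 ≤ 0 := by
        by_contra hcon
        have := (hpz (by omega)).1
        rw [this] at hcon
        exact hcon hu
      rw [h]
      rcases hdx with hdx | hdx
      · have := B2 (C := C) hadj 1 h1 hz0a hfz
        omega
      · have hlt := hdx (by omega) z0 hz0a hz0d hz0r
        obtain ⟨y, hy, hyz⟩ : ∃ y ∈ C.S x (C.R x + 1), y ≠ z0 := by
          by_contra hcon
          push Not at hcon
          have h6 := C.S_one x _ z0 (by omega) (by omega) hcon
          omega
        have hfy : f y ≤ 0 := by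
          by_cases hyi : y = C.u i
          · rw [hyi]; exact hu
          · by_contra hcon
            exact hcon (srcnon hc hr hy le_rfl (by omega) hyi (hf y (by omega)))
        have := B3 (C := C) hadj 1 h1 hz0a hfz (C.S_adj _ _ _ hy).symm hfy hyz
        omega
    · rw [h]
      by_cases hfz : f z0 ≤ 0
      · have := B2 (C := C) hadj 1 h1 hz0a hfz
        omega
      · obtain ⟨hzu, hkz⟩ := hpz (by omega)
        have hnb := C.nb i z0 x hz0a.symm
        obtain ⟨y, hy, hyz⟩ : ∃ y ∈ C.S x (C.R x + 2), y ≠ z0 := by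
          by_contra hcon
          push Not at hcon
          have h6 := C.S_one x _ z0 (by omega) (by omega) hcon
          omega
        have hfy : f y ≤ 0 := by
          by_contra hcon
          exact hcon (srcnon hc hr hy (by omega) (by omega) (hzu ▸ hyz) (hf y (by omega)))
        have := B2 (C := C) hadj 1 h1 (C.S_adj _ _ _ hy).symm hfy
        omega
  · have := B1 (C := C) hadj 1 h1
    have : C.D * 3 ≤ C.D * C.E x := Nat.mul_le_mul_left _ (by omega)
    omega

/-- Targets which are roots. -/
theorem T4 {x : V} {i : ι} (hc : C.c x = 1) (hr : 2 ≤ C.r i x)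
    (hx : x = C.u i) {dx : ℕ} (hdx : dx = 1 ∨
    (C.k x = C.r i x + 1 → ∀ z, ∃ y ∈ C.S x (C.r i x + 1), y ≠ z))
    {f : V → ℕ} (hf : ∀ y, 1 ≤ f y → C.Spec y x (f y)) :
    ∑ y, f y + 1 ≤ C.D * C.E x + C.c x + dx := by
  have hD := C.hD
  have hE := C.hE x
  obtain ⟨hRx, huniq⟩ := C.one hc (i := i) (by omega)
  have hadj : ∀ y, 1 ≤ f y → G.Adj x y := fun y hy => dem_adj (hf y hy) hy
  have h1 : ∀ y, f y ≤ 1 := fun y => by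
    rcases Nat.eq_zero_or_pos (f y) with h | h
    · omega
    · exact (T3dem hc hr (hf y h) h).1
  have hPx : C.P x = C.r i x := by
    have := C.pr i
    rwa [← hx] at this
  rcases Nat.lt_or_ge (C.E x) 3 with h3 | h3
  · rcases Nat.eq_zero_or_pos (C.E x) with h | h
    · have hb := B1 (C := C) hadj 0 (fun y => by
        by_contra hcon
        have := (T3dem hc hr (hf y (by omega)) (by omega)).2.1
        omega)
      omega
    · have hnon : ∀ y ∈ C.S x (C.r i x + 1), f y ≤ 0 := fun y hy => by
        by_contra hcon
        exact hcon (srcnon hc hr hy (by omega) (by omega)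
          (fun hyi => (C.S_adj _ _ _ hy).ne (hyi.trans hx.symm)) (hf y (by omega)))
      obtain ⟨y, hy⟩ := C.S_ne x (C.r i x + 1) (by omega) (by omega)
      have hb := B2 (C := C) hadj 1 h1 (C.S_adj _ _ _ hy).symm (hnon y hy)
      have : C.E x = 1 ∨ C.E x = 2 := by omega
      rcases this with h | h
      · rw [h]
        rcases hdx with hdx | hdx
        · omega
        · obtain ⟨y', hy', hne⟩ := hdx (by omega) y
          have := B3 (C := C) hadj 1 h1 (C.S_adj _ _ _ hy).symm (hnon y hy)
            (C.S_adj _ _ _ hy').symm (hnon y' hy') hne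
          omega
      · rw [h]
        omega
  · have := B1 (C := C) hadj 1 h1
    have : C.D * 3 ≤ C.D * C.E x := Nat.mul_le_mul_left _ (by omega)
    omega

/-- Targets covered at least twice. -/
theorem T5 {x : V} (hc : 2 ≤ C.c x) {f : V → ℕ} (hf : ∀ y, 1 ≤ f y → C.Spec y x (f y)) :
    ∑ y, f y + 1 ≤ C.D * C.E x + C.c x := by
  have hD := C.hD
  have hE := C.hE x
  have hkR : C.R x ≤ C.k x := C.kR x
  have hadj : ∀ y, 1 ≤ f y → G.Adj x y := fun y hy => dem_adj (hf y hy) hy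
  have h2 : ∀ y, f y ≤ 2 := fun y => by
    rcases Nat.eq_zero_or_pos (f y) with h | h
    · omega
    · exact dem_two (hf y h)
  obtain ⟨i, hi, hx⟩ := C.two hc
  obtain ⟨z0, hz0a, hz0d, hz0r⟩ := C.pred i x (by omega) hx
  have hRz := C.r_le i z0
  have hpz : 1 ≤ f z0 → z0 = C.u i ∧ C.k z0 = C.r i z0 + 1 ∧ 2 ≤ C.E x := fun h => by
    obtain ⟨a, b, c, d⟩ := dem_pred (hf z0 h) h hz0d (by omega)
    refine ⟨a, c, ?_⟩
    have hks := C.S_k _ _ _ d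
    have := C.almost hi (fun j hj => by
      by_contra hcon
      have := C.nb j x z0 hz0a
      exact hj ((C.one b (i := i) (by omega)).2 j (by omega)))
    omega
  by_cases h1 : ∀ y, f y ≤ 1
  · by_cases hE2 : 2 ≤ C.E x
    · have := B1 (C := C) hadj 1 h1
      have : C.D * 2 ≤ C.D * C.E x := Nat.mul_le_mul_left _ (by omega)
      omega
    · have hE1 : C.E x = 1 := by omega
      have hfz : f z0 ≤ 0 := by
        by_contra hcon
        have := (hpz (by omega)).2.2
        omega
      have := B2 (C := C) hadj 1 h1 hz0a hfz
      rw [hE1]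
      omega
  · push Not at h1
    obtain ⟨y2, hy2⟩ := h1
    obtain ⟨b1, b2, -⟩ := dem_two' (hf y2 (by omega)) hy2
    have hsm : ∀ j, C.r j x ≤ 1 := fun j => by
      have h3 := C.nb j x y2 (hadj y2 (by omega))
      have h4 := C.r_le j y2
      omega
    have hRc := C.small hsm
    rcases Nat.lt_or_ge (C.k x) 6 with h6 | h6
    · by_cases hfz : f z0 ≤ 0
      · have := B2 (C := C) hadj 2 h2 hz0a hfz
        have : C.D * 3 ≤ C.D * C.E x := Nat.mul_le_mul_left _ (by omega)
        omega
      · obtain ⟨hz1, hz2, -⟩ := hpz (by omega)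
        have hfz1 : f z0 ≤ 1 := dem_R (hf z0 (by omega)) (by omega)
        have := B2 (C := C) hadj 2 h2 hz0a hfz1
        rcases Nat.lt_or_ge (C.k x) 5 with h5 | h5
        · have hnb := C.nb i z0 x hz0a.symm
          have := hsm i
          have hP : C.P x ≤ 1 := by
            rcases C.Pcase x with h | ⟨j, _, h, _⟩
            · omega
            · have := hsm j; omega
          obtain ⟨y, hy, hyz⟩ : ∃ y ∈ C.S x 4, y ≠ z0 := by
            by_contra hcon
            push Not at hcon
            have h6 := C.S_one x 4 z0 (by omega) (by omega) hcon
            omega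
          have hky := C.S_k _ _ _ hy
          have hfy : f y ≤ 1 := by
            rcases Nat.eq_zero_or_pos (f y) with h0 | h0
            · omega
            · exact dem_big (hf y h0) (by omega) (by omega)
          have := B3 (C := C) hadj 2 h2 hz0a hfz1 (C.S_adj _ _ _ hy).symm hfy hyz
          have : C.D * 3 ≤ C.D * C.E x := Nat.mul_le_mul_left _ (by omega)
          omega
        · have : C.D * 4 ≤ C.D * C.E x := Nat.mul_le_mul_left _ (by omega)
          omega
    · have := B1 (C := C) hadj 2 h2
      have : C.D * 5 ≤ C.D * C.E x := Nat.mul_le_mul_left _ (by omega)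
      omega

theorem T0 {x : V} {dx : ℕ} (hk : C.k x = 1) (hd : 1 ≤ C.c x + dx)
    {f : V → ℕ} (hf : ∀ y, 1 ≤ f y → C.Spec y x (f y)) :
    ∑ y, f y + 1 ≤ C.D * C.E x + C.c x + dx := by
  have : ∑ y, f y = 0 := Finset.sum_eq_zero fun y _ => by
    by_contra h
    have := dem_k (hf y (by omega)) (by omega)
    omega
  omega

theorem target {x z : V} {dx : ℕ} (h : C.Spec x z dx)
    {f : V → ℕ} (hf : ∀ y, 1 ≤ f y → C.Spec y x (f y)) :
    ∑ y, f y + 1 ≤ C.D * C.E x + C.c x + dx := by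
  rcases h with ⟨a, b, c, d⟩ | ⟨a, b, c, d⟩ | ⟨a, b, c⟩ | ⟨i, a, b, c, d⟩ | ⟨i, a, b, c, d⟩ | ⟨a, b⟩
  · exact T0 b (by omega) hf
  · exact T12 a b c d hf
  · have hc : 1 ≤ C.c x := by
      rcases C.cls x with h | ⟨i, h, _⟩ | h <;> omega
    exact T0 c (by omega) hf
  · exact T3 a b c (by rcases d with d | d; exacts [Or.inl d.1, Or.inr d.2]) hf
  · exact T4 a b c (by rcases d with d | d; exacts [Or.inl d.1, Or.inr d.2]) hf
  · have := T5 a hf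
    omega

theorem total (C : Ctx V G ι) : Fintype.card V ≤ ∑ x, (C.D * C.E x + C.c x) := by
  choose par d hd using C.exists_spec
  have h1 : ∀ x, ∑ y, (if par y = x then d y else 0) + 1 ≤ C.D * C.E x + C.c x + d x := fun x =>
    target (hd x) (fun y hy => by
      by_cases h : par y = x
      · rw [if_pos h]; exact h ▸ hd y
      · rw [if_neg h] at hy; omega)
  have h2 := Finset.sum_le_sum (fun x (_ : x ∈ Finset.univ) => h1 x)
  rw [Finset.sum_add_distrib, Finset.sum_add_distrib, Finset.sum_comm] at h2
  have h3 : ∀ y, ∑ x, (if par y = x then d y else 0) = d y := fun y => by simp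
  rw [Finset.sum_congr rfl fun y _ => h3 y] at h2
  simp only [Finset.sum_const, Finset.card_univ, smul_eq_mul, mul_one] at h2
  linarith

end Ctx
end Peb

namespace Peb

variable {V : Type*} [Fintype V] [DecidableEq V] {G : SimpleGraph V}

theorem sum_dist (hconn : G.Connected) (w : V) :
    ∑ x, ((1 : ℚ) / 2) ^ G.dist w x = eff G w := by
  classical
  unfold eff
  have hmaps : ∀ x ∈ (Finset.univ : Finset V), G.dist w x ∈ Finset.range (G.diam + 1) := by
    intro x _
    have : Nonempty V := ⟨x⟩
    have := SimpleGraph.dist_le_diam (G := G) (SimpleGraph.connected_iff_ediam_ne_top.1 hconn)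
      (u := w) (v := x)
    simp; omega
  rw [← Finset.sum_fiberwise_of_maps_to hmaps]
  apply Finset.sum_congr rfl
  intro i _
  rw [Finset.sum_congr rfl (g := fun _ => ((1 : ℚ) / 2) ^ i) (by
    intro x hx
    rw [(Finset.mem_filter.1 hx).2])]
  rw [Finset.sum_const, nsmul_eq_mul, mul_comm]
  congr 2
  rw [← Set.ncard_coe_finset]
  congr 1
  ext x; simp

theorem dist_hom (hconn : G.Connected) (φ : G ≃g G) (w x : V) :
    G.dist (φ w) (φ x) ≤ G.dist w x := by
  obtain ⟨W, hW⟩ := hconn.exists_walk_length_eq_dist w x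
  rw [← hW, ← SimpleGraph.Walk.length_map φ.toHom W]
  exact SimpleGraph.dist_le _

theorem dist_iso (hconn : G.Connected) (φ : G ≃g G) (w x : V) :
    G.dist (φ w) (φ x) = G.dist w x := by
  apply le_antisymm (dist_hom hconn φ w x)
  simpa using dist_hom hconn φ.symm (φ w) (φ x)

theorem eff_eq (hconn : G.Connected) (htrans : ∀ u v : V, ∃ φ : G ≃g G, φ u = v) (w v : V) :
    eff G w = eff G v := by
  obtain ⟨φ, hφ⟩ := htrans w v
  rw [← sum_dist hconn, ← sum_dist hconn]
  apply Fintype.sum_equiv φ.toEquiv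
  intro x
  have : G.dist v (φ x) = G.dist w x := by
    rw [← hφ]
    exact dist_iso hconn φ w x
  simp only [RelIso.coe_fn_toEquiv]
  rw [this]

theorem eff_pos (hconn : G.Connected) (v : V) : 0 < eff G v := by
  rw [← sum_dist hconn]
  exact Finset.sum_pos (fun _ _ => by positivity) ⟨v, Finset.mem_univ v⟩

theorem sum_wt (hconn : G.Connected) (htrans : ∀ u v : V, ∃ φ : G ≃g G, φ u = v) (P : V → ℕ)
    (v : V) : ∑ x, wt G P x = (∑ w, (P w : ℚ)) * eff G v := by
  unfold wt
  rw [Finset.sum_comm, Finset.sum_mul]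
  apply Finset.sum_congr rfl
  intro w _
  rw [← Finset.mul_sum, sum_dist hconn, eff_eq hconn htrans w v]

theorem mk_ctx [DecidableRel G.Adj] (hconn : G.Connected) (hΔ : 3 ≤ G.maxDegree)
    (P : V → ℕ) (hP : Solvable G P)
    (t : ℕ) (U : Fin t → V → ℕ) (u : Fin t → V)
    (hunit : ∀ i, U i = fun w => if w = u i then P (u i) else 0)
    (hpos : ∀ i, 0 < P (u i)) (huinj : Function.Injective u)
    (hsum : ∀ v, P v = ∑ i, U i v) :
    ∃ C : Ctx V G (Fin t), C.k = reach G P ∧ C.r = (fun i x => reach G (U i) x) ∧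
      C.D = G.maxDegree - 2 := by
  have hM : ∀ x : V, ∃ M : Set V, P x < 2 → 2 ≤ reach G P x → M.Nonempty ∧ M ⊆ Src G P x 2 ∧
      (∀ y ∈ M, rk G P y < rk G P x) ∧
      (∀ z, (∀ y ∈ M, y = z) → KReachable G P (2 * (2 - P x)) z) ∧
      (P x = 0 → ∀ z, (∀ y ∈ M, y = z) → P z < 4 → ∃ y ∈ Src G P z 4, y ≠ x) := by
    intro x
    by_cases h : P x < 2 ∧ 2 ≤ reach G P x
    · obtain ⟨M, hM⟩ := exists_M h.1 ((kreach_iff hconn).2 h.2)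
      exact ⟨M, fun _ _ => hM⟩
    · exact ⟨∅, fun h1 h2 => absurd ⟨h1, h2⟩ h⟩
  choose M hM using hM
  have hreach : ∀ i x, reach G (U i) x = P (u i) / 2 ^ G.dist (u i) x := fun i x => by
    rw [hunit i]; exact unit_reach hconn _ _ _
  have hroot : ∀ i, reach G (U i) (u i) = P (u i) := fun i => by
    rw [hreach, SimpleGraph.dist_self]; simp
  have hnear : ∀ i x, x ≠ u i → ∃ z, G.Adj x z ∧ G.dist (u i) z + 1 = G.dist (u i) x := by
    intro i x hx
    obtain ⟨W, hW⟩ := hconn.exists_walk_length_eq_dist x (u i)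
    cases W with
    | nil => exact absurd rfl hx
    | @cons _ y _ h W =>
      refine ⟨y, h, ?_⟩
      have h1 : G.dist (u i) y ≤ W.length := by
        rw [SimpleGraph.dist_comm]; exact SimpleGraph.dist_le W
      have h2 := hconn.dist_triangle (u := u i) (v := y) (w := x)
      rw [SimpleGraph.dist_eq_one_iff_adj.2 h.symm] at h2
      rw [SimpleGraph.dist_comm] at hW
      simp at hW
      omega
  have hdiv : ∀ a d : ℕ, 2 * (a / 2 ^ (d + 1)) ≤ a / 2 ^ d := fun a d => by
    rw [pow_succ, ← Nat.div_div_eq_div_mul]; omega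
  refine ⟨{
    P := P
    k := reach G P
    u := u
    r := fun i x => reach G (U i) x
    ds := fun i x => G.dist (u i) x
    S := Src G P
    M := M
    rk := rk G P
    D := G.maxDegree - 2
    hD := by omega
    deg := fun x => by have := G.degree_le_maxDegree x; omega
    k1 := fun x => (kreach_iff hconn).1 (hP x)
    kR := fun x => by
      rw [← kreach_iff hconn]
      have h := kreach_sum (G := G) Finset.univ U (fun i => reach G (U i) x) x
        (fun i _ => (kreach_iff hconn).2 le_rfl)
      have hPU : P = ∑ i, U i := by
        funext w; rw [hsum w, Finset.sum_apply]
      rw [hPU]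
      exact h
    nb := fun i x y hxy => by
      have h := (kreach_iff hconn).1
        (kreach_half (G := G) hxy ((kreach_iff hconn).2 (le_refl (reach G (U i) x))))
      omega
    pred := fun i x _ hx => by
      obtain ⟨z, hz, hd⟩ := hnear i x hx
      refine ⟨z, hz, by omega, ?_⟩
      simp only [hreach]
      rw [← hd]
      exact hdiv _ _
    pr := fun i => (hroot i).symm
    ru := fun i => by simp only [hroot]; exact hpos i
    rle := fun i x hx => by
      obtain ⟨z, hz, hd⟩ := hnear i x hx
      simp only [hroot, hreach]
      rw [← hd]
      exact (hdiv _ _).trans (Nat.div_le_self _ _)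
    pz := fun x hx => by
      rw [hsum x]
      apply Finset.sum_eq_zero
      intro i _
      rw [hunit i]
      simp [hx i]
    uinj := fun i j h => huinj h
    S_adj := fun x y n h => src_adj h
    S_k := fun x y n h => (kreach_iff hconn).1 (src_k h)
    S_mono := fun x n n' h => src_mono h
    S_ne := fun x n h h' => src_ne h ((kreach_iff hconn).2 h')
    S_one := fun x n z h h' hz => (kreach_iff hconn).1 (src_single h ((kreach_iff hconn).2 h') hz)
    M_ne := fun x h h' => (hM x h h').1
    M_sub := fun x h h' => (hM x h h').2.1
    M_rk := fun x h h' => (hM x h h').2.2.1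
    M_one := fun x h h' z hz => (kreach_iff hconn).1 ((hM x h h').2.2.2.1 z hz)
    M_src := fun x h h' h0 => (hM x h h').2.2.2.2 h0 }, rfl, rfl, rfl⟩

end Peb

/-- For a solvable `P` on a connected vertex-transitive graph with `Δ ≥ 3`,
decomposed into disjoint units,
`|P| ≥ (((Δ−1)/(Δ−2))|V| + UE(P) − (1/(Δ−2)) ∑ cov(U_i)) / eff(v)`. -/
theorem stmt13 {V : Type*} [Fintype V] [DecidableEq V] (G : SimpleGraph V)
    [DecidableRel G.Adj] (hconn : G.Connected)
    (htrans : ∀ u v : V, ∃ φ : G ≃g G, φ u = v) (hΔ : 3 ≤ G.maxDegree)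
    (P : V → ℕ) (hP : Solvable G P)
    (t : ℕ) (U : Fin t → V → ℕ) (u : Fin t → V)
    (hunit : ∀ i, U i = fun w => if w = u i then P (u i) else 0)
    (hpos : ∀ i, 0 < P (u i)) (huinj : Function.Injective u)
    (hsum : ∀ v, P v = ∑ i, U i v)
    (v : V) :
    (((G.maxDegree : ℚ) - 1) / ((G.maxDegree : ℚ) - 2) * (Fintype.card V : ℚ)
        + (∑ i, (TE G (U i) : ℚ))
        - (1 / ((G.maxDegree : ℚ) - 2)) * ∑ i, (cov G (U i) : ℚ)) / eff G v
      ≤ ∑ w, (P w : ℚ) := by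
  obtain ⟨C, hk, hr, hD⟩ := Peb.mk_ctx hconn hΔ P hP t U u hunit hpos huinj hsum
  have htot := C.total
  have hpe := Peb.eff_pos hconn v
  have hwt := Peb.sum_wt hconn htrans P v
  have hkw : ∑ x, (C.k x : ℚ) ≤ ∑ x, Peb.wt G P x :=
    Finset.sum_le_sum fun x _ => by rw [hk]; exact Peb.reach_le_wt hconn P x
  have hDq : ((C.D : ℕ) : ℚ) = (G.maxDegree : ℚ) - 2 := by
    rw [hD]; push_cast [show 2 ≤ G.maxDegree by omega]; ring
  have hD1 : (1 : ℚ) ≤ (C.D : ℚ) := by exact_mod_cast C.hD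
  have hcov : ∑ i, (cov G (U i) : ℚ) = ∑ x, (C.c x : ℚ) := by
    have h1 : ∀ i, (cov G (U i) : ℚ) = ∑ x, if 1 ≤ C.r i x then (1 : ℚ) else 0 := by
      intro i
      rw [Finset.sum_boole, cov, ← Set.ncard_coe_finset]
      congr 2
      ext x
      simp [Reachable', Peb.kreach_iff hconn, hr]
    rw [Finset.sum_congr rfl fun i _ => h1 i, Finset.sum_comm]
    refine Finset.sum_congr rfl fun x _ => ?_
    rw [C.c_eq]
    push_cast
    rfl
  have hTE : ∑ i, (TE G (U i) : ℚ) = ∑ x, (C.R x : ℚ) - ∑ x, (C.c x : ℚ) := by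
    have h1 : ∀ i, (TE G (U i) : ℚ)
        = ∑ x, ((C.r i x : ℚ) - if 1 ≤ C.r i x then (1 : ℚ) else 0) := by
      intro i
      unfold TE
      push_cast
      refine Finset.sum_congr rfl fun x _ => ?_
      rw [hr, exc]
      simp only
      split_ifs with h
      · push_cast [h]; rfl
      · have : reach G (U i) x = 0 := by omega
        simp [this]
    rw [Finset.sum_congr rfl fun i _ => h1 i, Finset.sum_comm, ← Finset.sum_sub_distrib]
    refine Finset.sum_congr rfl fun x _ => ?_
    rw [C.c_eq, Peb.Ctx.R, Finset.sum_sub_distrib]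
    push_cast
    rfl
  have hEx : ∑ x, (C.E x : ℚ) + Fintype.card V + ∑ x, (C.R x : ℚ)
      = ∑ x, (C.k x : ℚ) + ∑ x, (C.c x : ℚ) := by
    have h1 : ∀ x, (C.E x : ℚ) + 1 + (C.R x : ℚ) = C.k x + C.c x := fun x => by
      exact_mod_cast C.hE x
    have h2 := Finset.sum_congr (rfl : (Finset.univ : Finset V) = Finset.univ) (fun x _ => h1 x)
    simpa [Finset.sum_add_distrib] using h2
  have htq : (Fintype.card V : ℚ) ≤ C.D * ∑ x, (C.E x : ℚ) + ∑ x, (C.c x : ℚ) := by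
    have : (Fintype.card V : ℚ) ≤ ((∑ x, (C.D * C.E x + C.c x) : ℕ) : ℚ) := by
      exact_mod_cast htot
    push_cast at this
    rwa [Finset.sum_add_distrib, ← Finset.mul_sum] at this
  rw [div_le_iff₀ hpe, hcov, hTE, ← hwt,
    show (G.maxDegree : ℚ) - 1 = C.D + 1 by rw [hDq]; ring, ← hDq]
  refine le_trans ?_ hkw
  have hD0 : (C.D : ℚ) ≠ 0 := by linarith
  have hDpos : (0 : ℚ) < C.D := by linarith
  have key : ((C.D : ℚ) + 1) * (Fintype.card V : ℚ) - ∑ x, (C.c x : ℚ)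
      ≤ C.D * (∑ x, (C.k x : ℚ) - (∑ x, (C.R x : ℚ) - ∑ x, (C.c x : ℚ))) := by
    have : ∑ x, (C.k x : ℚ) - (∑ x, (C.R x : ℚ) - ∑ x, (C.c x : ℚ))
      = ∑ x, (C.E x : ℚ) + Fintype.card V := by linarith
    rw [this]
    linarith
  rw [mul_comm (C.D : ℚ), ← div_le_iff₀ hDpos] at key
  have e1 : ((C.D : ℚ) + 1) / C.D * (Fintype.card V : ℚ) - 1 / C.D * ∑ x, (C.c x : ℚ)
    = (((C.D : ℚ) + 1) * (Fintype.card V : ℚ) - ∑ x, (C.c x : ℚ)) / C.D := by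
    field_simp
  linarith
end

section
/- The optimal pebbling number of the torus grid T_{m,n} = C_m □ C_n satisfies π_opt(T_{m,n}) ≥ (2/13)·m·n for all m,n ≥ 5. -/
open Finset

section helpers

variable {V : Type*}

/-- closed neighbourhood of a finite set -/
noncomputable def clN [Fintype V] (G : SimpleGraph V) (C : Finset V) : Finset V :=
  open Classical in univ.filter (fun v => v ∈ C ∨ ∃ u ∈ C, G.Adj u v)

/-- neighbours -/
noncomputable def nbF [Fintype V] (G : SimpleGraph V) (v : V) : Finset V :=
  open Classical in univ.filter (fun u => G.Adj v u)

lemma mem_clN [Fintype V] (G : SimpleGraph V) (C : Finset V) (v : V) :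
    v ∈ clN G C ↔ v ∈ C ∨ ∃ u ∈ C, G.Adj u v := by simp [clN]

lemma mem_nbF [Fintype V] (G : SimpleGraph V) (v u : V) :
    u ∈ nbF G v ↔ G.Adj v u := by simp [nbF]

/-- discharging inequality -/
lemma discharge [Fintype V] (G : SimpleGraph V) (hdeg : ∀ v, (nbF G v).card ≤ 4)
    (C : Finset V) (w : V → ℚ) (hw0 : ∀ v, 0 ≤ w v) (hw2 : ∀ v ∈ C, 2 ≤ w v)
    (hhalf : ∀ u v, G.Adj u v → w u ≤ 2 * w v)
    (hopp : ∀ x y, G.Adj x y → ∃ z, G.Adj y z ∧ w x + w z ≤ 5 / 2 * w y) :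
    (9 / 8 : ℚ) * (clN G C).card + 7 / 8 * C.card ≤ ∑ v, w v := by
  classical
  set N := clN G C with hN
  have hCN : C ⊆ N := fun v hv => (mem_clN G C v).2 (Or.inl hv)
  set B := N \ C with hB
  set O := univ \ N with hO
  have hcard : (B.card : ℚ) = N.card - C.card := by
    rw [hB, Finset.card_sdiff_of_subset hCN, Nat.cast_sub (Finset.card_le_card hCN)]
  have hsplit : ∑ v, w v = ∑ v ∈ O, w v + (∑ v ∈ B, w v + ∑ v ∈ C, w v) := by
    rw [hB, hO, Finset.sum_sdiff hCN, Finset.sum_sdiff (Finset.subset_univ N)]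
  have hN1 : ∀ v ∈ N, 1 ≤ w v := by
    intro v hv
    rcases (mem_clN G C v).1 hv with h | ⟨u, hu, huv⟩
    · linarith [hw2 v h]
    · linarith [hw2 u hu, hhalf u v huv]
  have hC : (2 : ℚ) * C.card ≤ ∑ v ∈ C, w v := by
    have := Finset.card_nsmul_le_sum C w 2 hw2
    simpa [mul_comm] using this
  have hy : ∀ y ∈ B, (9 / 8 : ℚ) ≤ w y + ∑ z ∈ O, if G.Adj y z then w z / 4 else 0 := by
    intro y hy
    have hyN : y ∈ N := (Finset.mem_sdiff.1 hy).1
    have hyC : y ∉ C := (Finset.mem_sdiff.1 hy).2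
    obtain ⟨x, hx, hxy⟩ := ((mem_clN G C y).1 hyN).resolve_left hyC
    obtain ⟨z, hyz, hz⟩ := hopp x y hxy
    have hnn : ∀ z ∈ O, 0 ≤ (if G.Adj y z then w z / 4 else 0) := by
      intro z _
      split_ifs
      · linarith [hw0 z]
      · exact le_rfl
    by_cases hzN : z ∈ N
    · have := Finset.sum_nonneg hnn
      linarith [hN1 z hzN, hw2 x hx]
    · have h1 := Finset.single_le_sum hnn (Finset.mem_sdiff.2 ⟨Finset.mem_univ z, hzN⟩)
      rw [if_pos hyz] at h1
      linarith [hN1 y hyN, hw2 x hx, hhalf y z hyz]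
  have hO' : ∑ y ∈ B, ∑ z ∈ O, (if G.Adj y z then w z / 4 else 0) ≤ ∑ z ∈ O, w z := by
    rw [Finset.sum_comm]
    apply Finset.sum_le_sum
    intro z _
    rw [← Finset.sum_filter, Finset.sum_const, nsmul_eq_mul]
    have h1 : (B.filter (fun y => G.Adj y z)).card ≤ 4 := by
      refine le_trans (Finset.card_le_card ?_) (hdeg z)
      intro y hy
      exact (mem_nbF G z y).2 (Finset.mem_filter.1 hy).2.symm
    have h2 : ((B.filter (fun y => G.Adj y z)).card : ℚ) ≤ 4 := by exact_mod_cast h1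
    nlinarith [hw0 z]
  have hsum : (9 / 8 : ℚ) * B.card ≤
      ∑ y ∈ B, w y + ∑ y ∈ B, ∑ z ∈ O, (if G.Adj y z then w z / 4 else 0) := by
    rw [← Finset.sum_add_distrib]
    have := Finset.card_nsmul_le_sum B _ _ hy
    rw [nsmul_eq_mul] at this
    linarith
  rw [hsplit]
  rw [hcard] at hsum
  linarith

/-- connected sets have closed neighbourhood at most `3|C|+2` -/
lemma card_clN_le [Fintype V] (G : SimpleGraph V) (hdeg : ∀ v, (nbF G v).card ≤ 4)
    (C : Finset V) (v₀ : V) (hv₀ : v₀ ∈ C)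
    (hconn : ∀ A : Finset V, A ⊆ C → v₀ ∈ A →
      (∀ a ∈ A, ∀ b ∈ C, G.Adj a b → b ∈ A) → A = C) :
    (clN G C).card ≤ 3 * C.card + 2 := by
  classical
  obtain ⟨A, hA, hmax⟩ := Finset.exists_max_image
    (C.powerset.filter (fun A => v₀ ∈ A ∧ (clN G A).card ≤ 3 * A.card + 2)) Finset.card
    ⟨{v₀}, by
      simp only [Finset.mem_filter, Finset.mem_powerset, Finset.singleton_subset_iff,
        Finset.mem_singleton, Finset.card_singleton, true_and]
      refine ⟨hv₀, ?_⟩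
      have : clN G {v₀} ⊆ insert v₀ (nbF G v₀) := by
        intro x hx
        rw [mem_clN] at hx
        simpa [mem_nbF] using hx
      have h1 := Finset.card_le_card this
      have h2 := Finset.card_insert_le v₀ (nbF G v₀)
      have := hdeg v₀
      omega⟩
  simp only [Finset.mem_filter, Finset.mem_powerset] at hA hmax
  obtain ⟨hAC, hvA, hcA⟩ := hA
  rw [← hconn A hAC hvA ?_]
  · exact hcA
  intro a ha b hb hab
  by_contra hbA
  have hsub : clN G (insert b A) ⊆ clN G A ∪ (nbF G b).erase a := by
    intro x hx
    rw [mem_clN] at hx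
    simp only [Finset.mem_union, Finset.mem_erase, mem_nbF, mem_clN]
    rcases hx with hx | ⟨u, hu, hux⟩
    · rcases Finset.mem_insert.1 hx with rfl | hx
      · exact Or.inl (Or.inr ⟨a, ha, hab⟩)
      · exact Or.inl (Or.inl hx)
    · rcases Finset.mem_insert.1 hu with rfl | hu
      · by_cases hxa : x = a
        · subst hxa; exact Or.inl (Or.inl ha)
        · exact Or.inr ⟨hxa, hux⟩
      · exact Or.inl (Or.inr ⟨u, hu, hux⟩)
  have h1 := Finset.card_le_card hsub
  have h2 := Finset.card_union_le (clN G A) ((nbF G b).erase a)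
  have h3 : ((nbF G b).erase a).card = (nbF G b).card - 1 :=
    Finset.card_erase_of_mem ((mem_nbF G b a).2 hab.symm)
  have h4 := hdeg b
  have h5 := Finset.card_insert_of_notMem hbA
  have := hmax (insert b A) ⟨Finset.insert_subset hb hAC, Finset.mem_insert_of_mem hvA, by omega⟩
  omega

variable [DecidableEq V]

lemma exec_append (G : SimpleGraph V) (σ τ : List (PMove V)) (p : V → ℕ) :
    Executable G p (σ ++ τ) ↔ Executable G p σ ∧ Executable G (applySeq p σ) τ := by
  induction σ generalizing p with
  | nil => simp [Executable, applySeq]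
  | cons m σ ih => simp [Executable, applySeq, ih, and_assoc]

/-- potential does not increase when no executable move enters `C` from outside -/
lemma potential_move [Fintype V] (G : SimpleGraph V) (C : Finset V) (K : V → ℚ)
    (hK0 : ∀ v, 0 ≤ K v) (hK : ∀ u v, G.Adj u v → K v ≤ 2 * K u) (q : V → ℕ) (m : PMove V)
    (hadj : G.Adj m.src m.tgt) (h2 : 2 ≤ q m.src) (hin : m.tgt ∈ C → m.src ∈ C) :
    ∑ u ∈ C, (applyMove q m u : ℚ) * K u ≤ ∑ u ∈ C, (q u : ℚ) * K u := by
  have hne : m.tgt ≠ m.src := hadj.ne'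
  have key : ∀ u, (applyMove q m u : ℚ) * K u =
      q u * K u + ((if u = m.tgt then K u else 0) - (if u = m.src then 2 * K u else 0)) := by
    intro u
    unfold applyMove
    by_cases h : u = m.src
    · subst h
      rw [if_pos rfl, if_neg hne.symm, if_pos rfl, Nat.cast_sub h2]
      push_cast; ring
    · rw [if_neg h, if_neg h]
      by_cases h' : u = m.tgt
      · rw [if_pos h', if_pos h']; push_cast; ring
      · rw [if_neg h', if_neg h']; ring
  rw [Finset.sum_congr rfl (fun u _ => key u), Finset.sum_add_distrib, Finset.sum_sub_distrib,
    Finset.sum_ite_eq', Finset.sum_ite_eq']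
  have := hK _ _ hadj
  have := hK0 m.src
  split_ifs with h1 h3 h3
  · linarith
  · exact absurd (hin h1) h3
  · linarith
  · linarith

lemma potential_seq [Fintype V] (G : SimpleGraph V) (C : Finset V) (K : V → ℚ)
    (hK0 : ∀ v, 0 ≤ K v) (hK : ∀ u v, G.Adj u v → K v ≤ 2 * K u) (p : V → ℕ)
    (hC : ∀ a b, G.Adj a b → b ∈ C → KReachable G p 2 a → a ∈ C) (τ : List (PMove V)) :
    ∀ σ : List (PMove V), Executable G p (σ ++ τ) →
    ∑ u ∈ C, (applySeq p (σ ++ τ) u : ℚ) * K u ≤ ∑ u ∈ C, (applySeq p σ u : ℚ) * K u := by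
  induction τ with
  | nil => intro σ _; simp
  | cons m τ ih =>
    intro σ h
    have h' : Executable G p ((σ ++ [m]) ++ τ) := by simpa using h
    have h1 := ih (σ ++ [m]) h'
    obtain ⟨hσ, hm⟩ := (exec_append G σ (m :: τ) p).1 h
    have h2 := potential_move G C K hK0 hK (applySeq p σ) m hm.1 hm.2.1
      (fun ht => hC _ _ hm.1 ht ⟨σ, hσ, hm.2.1⟩)
    have h3 : applySeq p (σ ++ [m]) = applyMove (applySeq p σ) m := by simp [applySeq]
    rw [h3] at h1
    simp only [List.append_assoc, List.singleton_append] at h1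
    exact h1.trans h2

/-- an unpebbled reachable vertex has a 2-reachable neighbour -/
lemma exists_nb_two (G : SimpleGraph V) (p : V → ℕ) (v : V) (h0 : p v = 0)
    (hr : Reachable' G p v) : ∃ u, G.Adj u v ∧ KReachable G p 2 u := by
  obtain ⟨σ, hσ, h1⟩ := hr
  have : ∀ τ σ : List (PMove V), Executable G p (σ ++ τ) → applySeq p σ v = 0 →
      1 ≤ applySeq p (σ ++ τ) v → ∃ u, G.Adj u v ∧ KReachable G p 2 u := by
    intro τ
    induction τ with
    | nil => intro σ _ h h'; simp at h'; omega
    | cons m τ ih =>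
      intro σ h hz hf
      obtain ⟨hσ, hm⟩ := (exec_append G σ (m :: τ) p).1 h
      by_cases hv : m.tgt = v
      · exact ⟨m.src, hv ▸ hm.1, σ, hσ, hm.2.1⟩
      · refine ih (σ ++ [m]) (by simpa using h) ?_ (by simpa using hf)
        have h3 : applySeq p (σ ++ [m]) = applyMove (applySeq p σ) m := by simp [applySeq]
        rw [h3]
        unfold applyMove
        split_ifs with a b
        · omega
        · exact absurd b.symm hv
        · exact hz
  exact this σ [] (by simpa using hσ) (by simpa [applySeq] using h0) (by simpa using h1)

/-- Abstract form of the bound. -/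
lemma abstract_bound [Fintype V] (G : SimpleGraph V) (hdeg : ∀ v, (nbF G v).card ≤ 4)
    (K : V → V → ℚ) (hK0 : ∀ u v, 0 ≤ K u v) (hK1 : ∀ v, 1 ≤ K v v)
    (hKl : ∀ u u' v, G.Adj u u' → K u' v ≤ 2 * K u v)
    (hKr : ∀ u v v', G.Adj v v' → K u v ≤ 2 * K u v')
    (hopp : ∀ x y, G.Adj x y → ∃ z, G.Adj y z ∧ ∀ u, K u x + K u z ≤ 5 / 2 * K u y)
    (hsum : ∀ u, ∑ v, K u v ≤ 9) (p : V → ℕ) (hp : Solvable G p) :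
    2 * Fintype.card V ≤ 13 * ∑ v, p v := by
  classical
  let H : SimpleGraph V := 
    { Adj := fun a b => G.Adj a b ∧ KReachable G p 2 a ∧ KReachable G p 2 b
      symm := ⟨fun a b h => ⟨h.1.symm, h.2.2, h.2.1⟩⟩
      loopless := ⟨fun a h => G.irrefl h.1⟩ }
  let f : V → H.ConnectedComponent := H.connectedComponentMk
  let comp : H.ConnectedComponent → Finset V := fun c => univ.filter (fun v => f v = c)
  let D : H.ConnectedComponent → Finset V := fun c =>
    if ∃ v ∈ comp c, KReachable G p 2 v then clN G (comp c)
    else (comp c).filter (fun v => p v ≠ 0)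
  have hmc : ∀ v c, v ∈ comp c ↔ f v = c := by intro v c; simp [comp]
  have hcover : (univ : Finset V) ⊆ univ.biUnion D := by
    intro v _
    rw [Finset.mem_biUnion]
    by_cases hv : p v = 0
    · obtain ⟨u, huv, hu⟩ := exists_nb_two G p v hv (hp v)
      refine ⟨f u, Finset.mem_univ _, ?_⟩
      have hu' : u ∈ comp (f u) := (hmc _ _).2 rfl
      simp only [D]
      rw [if_pos ⟨u, hu', hu⟩, mem_clN]
      exact Or.inr ⟨u, hu', huv⟩
    · refine ⟨f v, Finset.mem_univ _, ?_⟩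
      have hv' : v ∈ comp (f v) := (hmc _ _).2 rfl
      simp only [D]
      split_ifs
      · exact (mem_clN _ _ _).2 (Or.inl hv')
      · exact Finset.mem_filter.2 ⟨hv', hv⟩
  have hbound : ∀ c, 2 * (D c).card ≤ 13 * ∑ v ∈ comp c, p v := by
    intro c
    by_cases hc : ∃ v ∈ comp c, KReachable G p 2 v
    · simp only [D]
      rw [if_pos hc]
      obtain ⟨v₀, hv₀, hr₀⟩ := hc
      set C := comp c with hCdef
      -- all of C is 2-reachable
      have hreachall : ∀ v ∈ C, H.Reachable v₀ v := by
        intro v hv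
        apply SimpleGraph.ConnectedComponent.exact
        exact ((hmc _ _).1 hv₀).trans ((hmc _ _).1 hv).symm
      have hind : ∀ P : V → Prop, P v₀ → (∀ a b, H.Adj a b → P a → P b) → ∀ v ∈ C, P v := by
        intro P h0 hstep v hv
        obtain ⟨wk⟩ := hreachall v hv
        clear hv hv₀ hreachall hr₀
        induction wk with
        | nil => exact h0
        | cons h _ ih => exact ih (hstep _ _ h h0)
      have hC2 : ∀ v ∈ C, KReachable G p 2 v := hind _ hr₀ (fun a b h _ => h.2.2)
      have hclosed : ∀ a b, G.Adj a b → b ∈ C → KReachable G p 2 a → a ∈ C := by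
        intro a b hab hb ha
        rw [hmc] at hb ⊢
        rw [← hb]
        apply SimpleGraph.ConnectedComponent.sound
        exact SimpleGraph.Adj.reachable ⟨hab, ha, hC2 b ((hmc _ _).2 hb)⟩
      have hcl := card_clN_le G hdeg C v₀ hv₀ (by
        intro A hAC hvA hA
        refine Finset.Subset.antisymm hAC ?_
        intro v hv
        refine (hind (fun v => v ∈ A) hvA ?_ v hv)
        intro a b hab haA
        exact hA a haA b (hclosed b a hab.1.symm (hAC haA) hab.2.2) hab.1)
      have hdis := discharge G hdeg C (fun v => ∑ u ∈ C, (p u : ℚ) * K u v)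
        (fun v => Finset.sum_nonneg (fun u _ => mul_nonneg (Nat.cast_nonneg _) (hK0 u v)))
        (by
          intro v hv
          obtain ⟨σ, hσ, h2⟩ := hC2 v hv
          have h := potential_seq G C (fun u => K u v) (fun u => hK0 u v)
            (fun u u' h => hKl u u' v h) p hclosed σ [] (by simpa using hσ)
          refine le_trans ?_ h
          simp only [List.nil_append]
          have h3 := Finset.single_le_sum (f := fun u => (applySeq p σ u : ℚ) * K u v)
            (fun u _ => mul_nonneg (Nat.cast_nonneg _) (hK0 u v)) hv
          refine le_trans ?_ h3
          have h4 : (2 : ℚ) ≤ applySeq p σ v := by exact_mod_cast h2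
          nlinarith [hK1 v])
        (by
          intro a b hab
          rw [Finset.mul_sum]
          apply Finset.sum_le_sum
          intro u _
          have := mul_le_mul_of_nonneg_left (hKr u a b hab) (Nat.cast_nonneg (α := ℚ) (p u))
          linarith)
        (by
          intro x y hxy
          obtain ⟨z, hyz, hz⟩ := hopp x y hxy
          refine ⟨z, hyz, ?_⟩
          rw [Finset.mul_sum, ← Finset.sum_add_distrib]
          apply Finset.sum_le_sum
          intro u _
          have := mul_le_mul_of_nonneg_left (hz u) (Nat.cast_nonneg (α := ℚ) (p u))
          linarith)
      have htot : ∑ v, ∑ u ∈ C, (p u : ℚ) * K u v ≤ 9 * ((∑ u ∈ C, p u : ℕ) : ℚ) := by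
        rw [Finset.sum_comm]
        push_cast
        rw [Finset.mul_sum]
        apply Finset.sum_le_sum
        intro u _
        rw [← Finset.mul_sum]
        have := mul_le_mul_of_nonneg_left (hsum u) (Nat.cast_nonneg (α := ℚ) (p u))
        linarith
      have h1 := hdis.trans htot
      have h2 : 9 * (clN G C).card + 7 * C.card ≤ 72 * ∑ u ∈ C, p u := by
        have : (9 : ℚ) * (clN G C).card + 7 * C.card ≤ 72 * ((∑ u ∈ C, p u : ℕ) : ℚ) := by
          linarith
        exact_mod_cast this
      omega
    · simp only [D]
      rw [if_neg hc]
      have h1 : ((comp c).filter (fun v => p v ≠ 0)).card ≤ ∑ v ∈ comp c, p v := by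
        rw [Finset.card_filter]
        apply Finset.sum_le_sum
        intro v _
        split_ifs <;> omega
      omega
  have h1 : Fintype.card V ≤ ∑ c, (D c).card :=
    (Finset.card_le_card hcover).trans Finset.card_biUnion_le
  have h2 : ∑ c, ∑ v ∈ comp c, p v = ∑ v, p v :=
    Finset.sum_fiberwise univ f p
  calc 2 * Fintype.card V ≤ 2 * ∑ c, (D c).card := by omega
    _ = ∑ c, 2 * (D c).card := by rw [Finset.mul_sum]
    _ ≤ ∑ c, 13 * ∑ v ∈ comp c, p v := Finset.sum_le_sum (fun c _ => hbound c)
    _ = 13 * ∑ v, p v := by rw [← Finset.mul_sum, h2]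

end helpers

/-- one-dimensional kernel -/
noncomputable def gk (m : ℕ) (i : Fin m) : ℚ :=
  ((2 : ℚ) ^ (m - (i : ℕ)) + 2 ^ (i : ℕ)) / (2 ^ m - 1)

lemma gk_den (k : ℕ) : (0 : ℚ) < 2 ^ (k + 3) - 1 := by
  have : (1 : ℚ) ≤ 2 ^ k := one_le_pow₀ (by norm_num)
  rw [pow_add]; linarith

lemma gk_nonneg (k : ℕ) (i : Fin (k + 3)) : 0 ≤ gk (k + 3) i := by
  unfold gk
  have := gk_den k
  positivity

lemma gk_zero (k : ℕ) : 1 ≤ gk (k + 3) 0 := by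
  unfold gk
  rw [le_div_iff₀ (gk_den k)]
  simp
  linarith

/-- both step inequalities and the three-term inequality -/
lemma gk_step (k : ℕ) (i : Fin (k + 3)) :
    gk (k + 3) (i + 1) ≤ 2 * gk (k + 3) i ∧ gk (k + 3) i ≤ 2 * gk (k + 3) (i + 1) := by
  have hd := gk_den k
  have h1 : (1 : ℚ) ≤ 2 ^ k := one_le_pow₀ (by norm_num)
  unfold gk
  rw [← mul_div_assoc, ← mul_div_assoc, div_le_div_iff_of_pos_right hd,
    div_le_div_iff_of_pos_right hd]
  rcases Fin.eq_castSucc_or_eq_last i with ⟨j, rfl⟩ | rfl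
  · have hj : ((j.castSucc + 1 : Fin (k + 3)) : ℕ) = j + 1 := by simp
    rw [hj]
    obtain ⟨l, hl⟩ : ∃ l, k + 2 = j + 1 + l := ⟨k + 1 - j, by omega⟩
    have e1 : k + 3 - (j + 1) = l + 1 := by omega
    have e2 : k + 3 - ((j.castSucc : Fin (k + 3)) : ℕ) = l + 2 := by simp; omega
    rw [e1, e2]
    simp only [Fin.val_castSucc, pow_succ]
    have : (0 : ℚ) < 2 ^ (j : ℕ) := by positivity
    have : (0 : ℚ) < 2 ^ l := by positivity
    constructor <;> linarith
  · have : Fin.last (k + 2) + 1 = 0 := by simp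
    rw [this]
    have e2 : k + 3 - ((Fin.last (k + 2) : Fin (k + 3)) : ℕ) = 1 := by simp
    rw [e2]
    simp [pow_succ]
    constructor <;> linarith

lemma gk_three (k : ℕ) (i : Fin (k + 3)) :
    gk (k + 3) (i - 1) + gk (k + 3) (i + 1) ≤ 5 / 2 * gk (k + 3) i := by
  have hd := gk_den k
  have h1 : (1 : ℚ) ≤ 2 ^ k := one_le_pow₀ (by norm_num)
  unfold gk
  rw [← mul_div_assoc, ← add_div, div_le_div_iff_of_pos_right hd]
  by_cases h0 : (i : ℕ) = 0
  · have : i = 0 := Fin.ext h0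
    subst this
    have a1 : ((0 - 1 : Fin (k + 3)) : ℕ) = k + 2 := by
      rw [zero_sub, Fin.coe_neg_one]
    have a2 : ((0 + 1 : Fin (k + 3)) : ℕ) = 1 := by simp
    rw [a1, a2]
    have e1 : k + 3 - (k + 2) = 1 := by omega
    have e2 : k + 3 - 1 = k + 2 := by omega
    rw [e1, e2]
    simp [pow_succ]
    linarith
  · have a1 : ((i - 1 : Fin (k + 3)) : ℕ) = i - 1 := by
      rw [Fin.val_sub_one_of_ne_zero]
      intro h; exact h0 (by simp [h])
    rw [a1]
    by_cases hl : i = Fin.last (k + 2)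
    · subst hl
      have : Fin.last (k + 2) + 1 = 0 := by simp
      rw [this]
      have e1 : k + 3 - ((Fin.last (k + 2) : Fin (k + 3)) : ℕ) = 1 := by simp
      have e2 : k + 3 - (((Fin.last (k + 2) : Fin (k + 3)) : ℕ) - 1) = 2 := by simp
      have e3 : (((Fin.last (k + 2) : Fin (k + 3)) : ℕ) - 1) = k + 1 := by simp
      rw [e1, e2, e3]
      simp [pow_succ]
      linarith
    · have a2 : ((i + 1 : Fin (k + 3)) : ℕ) = i + 1 := by
        rw [Fin.val_add_one, if_neg hl]
      rw [a2]
      have hi : (i : ℕ) ≠ k + 2 := fun h => hl (Fin.ext h)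
      have hi2 := i.2
      obtain ⟨s, hs⟩ : ∃ s, (i : ℕ) = s + 1 := ⟨i - 1, by omega⟩
      obtain ⟨t, ht⟩ : ∃ t, k + 3 = s + 2 + t := ⟨k + 1 - s, by omega⟩
      rw [hs, ht]
      have e1 : s + 2 + t - (s + 1 - 1) = t + 2 := by omega
      have e2 : s + 2 + t - (s + 1 + 1) = t := by omega
      have e3 : s + 2 + t - (s + 1) = t + 1 := by omega
      rw [e1, e2, e3, Nat.add_sub_cancel]
      simp only [pow_succ]
      linarith

lemma gk_sum (k : ℕ) : ∑ i, gk (k + 3) i = 3 := by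
  unfold gk
  rw [← Finset.sum_div, div_eq_iff (gk_den k).ne']
  have h : ∀ m : ℕ, ∑ i : Fin m, ((2 : ℚ) ^ (m - (i : ℕ)) + 2 ^ (i : ℕ)) = 3 * (2 ^ m - 1) := by
    intro m
    rw [Fin.sum_univ_eq_sum_range (fun i => (2 : ℚ) ^ (m - i) + 2 ^ i) m,
      Finset.sum_add_distrib]
    have h1 : ∀ m : ℕ, ∑ i ∈ range m, (2 : ℚ) ^ i = 2 ^ m - 1 := by
      intro m
      rw [geom_sum_eq (by norm_num)]; norm_num
    have h2 : ∑ i ∈ range m, (2 : ℚ) ^ (m - i) = 2 * (2 ^ m - 1) := by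
      rw [← h1 m, Finset.mul_sum, ← Finset.sum_range_reflect]
      apply Finset.sum_congr rfl
      intro i hi
      have := Finset.mem_range.1 hi
      rw [← pow_succ']
      congr 1
      omega
    rw [h1, h2]; ring
  exact h _

/-- adjacency in a cycle -/
lemma cyc_adj (k : ℕ) (u v : Fin (k + 3)) :
    (SimpleGraph.cycleGraph (k + 3)).Adj u v ↔ v = u + 1 ∨ u = v + 1 := by
  rw [SimpleGraph.cycleGraph_adj, or_comm, sub_eq_iff_eq_add', sub_eq_iff_eq_add']

lemma gk_adj_le (k : ℕ) (a b : Fin (k + 3))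
    (h : b = a + 1 ∨ a = b + 1) :
    gk (k + 3) b ≤ 2 * gk (k + 3) a := by
  rcases h with rfl | rfl
  · exact (gk_step k a).1
  · exact (gk_step k b).2

/-- `π_opt(C_m □ C_n) ≥ (2/13)·m·n` for all `m, n ≥ 5`. -/
theorem stmt17 (m n : ℕ) (hm : 5 ≤ m) (hn : 5 ≤ n) :
    (2 / 13 : ℚ) * m * n
      ≤ (piOpt ((SimpleGraph.cycleGraph m).boxProd (SimpleGraph.cycleGraph n)) : ℚ) := by
  obtain ⟨k, rfl⟩ : ∃ k, m = k + 3 := ⟨m - 3, by omega⟩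
  obtain ⟨l, rfl⟩ : ∃ l, n = l + 3 := ⟨n - 3, by omega⟩
  set G := (SimpleGraph.cycleGraph (k + 3)).boxProd (SimpleGraph.cycleGraph (l + 3)) with hG
  have hadj : ∀ x y : Fin (k + 3) × Fin (l + 3), G.Adj x y ↔
      ((y.1 = x.1 + 1 ∨ x.1 = y.1 + 1) ∧ x.2 = y.2) ∨
      ((y.2 = x.2 + 1 ∨ x.2 = y.2 + 1) ∧ x.1 = y.1) := by
    intro x y
    rw [hG, SimpleGraph.boxProd_adj, cyc_adj, cyc_adj]
  have hmem : piOpt G ∈ {s | ∃ p : Fin (k + 3) × Fin (l + 3) → ℕ,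
      Solvable G p ∧ ∑ v, p v = s} := by
    apply Nat.sInf_mem
    exact ⟨_, fun _ => 1, fun v => ⟨[], trivial, le_rfl⟩, rfl⟩
  obtain ⟨p, hp, hps⟩ := hmem
  have hmain := abstract_bound G ?_
    (fun u v => gk (k + 3) (v.1 - u.1) * gk (l + 3) (v.2 - u.2)) ?_ ?_ ?_ ?_ ?_ ?_ p hp
  · rw [hps] at hmain
    simp only [Fintype.card_prod, Fintype.card_fin] at hmain
    have h : (2 : ℚ) * (((k + 3 : ℕ) : ℚ) * ((l + 3 : ℕ) : ℚ)) ≤ 13 * (piOpt G : ℚ) := by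
      exact_mod_cast hmain
    linarith
  · intro v
    have : nbF G v ⊆ {(v.1 + 1, v.2), (v.1 - 1, v.2), (v.1, v.2 + 1), (v.1, v.2 - 1)} := by
      intro u hu
      rw [mem_nbF, hadj] at hu
      obtain ⟨a, b⟩ := v
      obtain ⟨c, d⟩ := u
      simp only [Finset.mem_insert, Finset.mem_singleton, Prod.mk.injEq]
      simp only at hu
      rcases hu with ⟨h | h, h'⟩ | ⟨h | h, h'⟩ <;> subst h <;> subst h' <;> simp
    exact (Finset.card_le_card this).trans Finset.card_le_four
  · intro u v
    exact mul_nonneg (gk_nonneg _ _) (gk_nonneg _ _)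
  · intro v
    simp only [sub_self]
    nlinarith [gk_zero k, gk_zero l]
  · rintro ⟨a, b⟩ ⟨c, d⟩ ⟨e, f⟩ h
    rw [hadj] at h
    simp only at h ⊢
    rcases h with ⟨h, rfl⟩ | ⟨h, rfl⟩
    · have := gk_adj_le k (e - a) (e - c) (by
        rcases h with rfl | rfl
        · right; abel
        · left; abel)
      nlinarith [gk_nonneg l (f - b)]
    · have := gk_adj_le l (f - b) (f - d) (by
        rcases h with rfl | rfl
        · right; abel
        · left; abel)
      nlinarith [gk_nonneg k (e - a)]
  · rintro ⟨e, f⟩ ⟨a, b⟩ ⟨c, d⟩ h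
    rw [hadj] at h
    simp only at h ⊢
    rcases h with ⟨h, rfl⟩ | ⟨h, rfl⟩
    · have := gk_adj_le k (c - e) (a - e) (by
        rcases h with rfl | rfl
        · right; abel
        · left; abel)
      nlinarith [gk_nonneg l (b - f)]
    · have := gk_adj_le l (d - f) (b - f) (by
        rcases h with rfl | rfl
        · right; abel
        · left; abel)
      nlinarith [gk_nonneg k (a - e)]
  · rintro ⟨a, b⟩ ⟨c, d⟩ h
    rw [hadj] at h
    simp only at h
    rcases h with ⟨rfl | rfl, rfl⟩ | ⟨rfl | rfl, rfl⟩
    · refine ⟨(a + 1 + 1, b), (hadj _ _).2 (by simp), ?_⟩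
      rintro ⟨e, f⟩
      have h3 := gk_three k (a + 1 - e)
      rw [show a + 1 - e - 1 = a - e by abel, show a + 1 - e + 1 = a + 1 + 1 - e by abel] at h3
      simp only
      nlinarith [gk_nonneg l (b - f)]
    · refine ⟨(c - 1, b), (hadj _ _).2 (by simp), ?_⟩
      rintro ⟨e, f⟩
      have h3 := gk_three k (c - e)
      rw [show c - e - 1 = c - 1 - e by abel, show c - e + 1 = c + 1 - e by abel] at h3
      simp only
      nlinarith [gk_nonneg l (b - f)]
    · refine ⟨(a, b + 1 + 1), (hadj _ _).2 (by simp), ?_⟩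
      rintro ⟨e, f⟩
      have h3 := gk_three l (b + 1 - f)
      rw [show b + 1 - f - 1 = b - f by abel, show b + 1 - f + 1 = b + 1 + 1 - f by abel] at h3
      simp only
      nlinarith [gk_nonneg k (a - e)]
    · refine ⟨(a, d - 1), (hadj _ _).2 (by simp), ?_⟩
      rintro ⟨e, f⟩
      have h3 := gk_three l (d - f)
      rw [show d - f - 1 = d - 1 - f by abel, show d - f + 1 = d + 1 - f by abel] at h3
      simp only
      nlinarith [gk_nonneg k (a - e)]
  · rintro ⟨e, f⟩
    rw [Fintype.sum_prod_type]
    simp only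
    rw [← Fintype.sum_mul_sum]
    have h1 : ∑ i, gk (k + 3) (i - e) = 3 := by
      rw [← gk_sum k]
      exact Equiv.sum_comp (Equiv.subRight e) (gk (k + 3))
    have h2 : ∑ i, gk (l + 3) (i - f) = 3 := by
      rw [← gk_sum l]
      exact Equiv.sum_comp (Equiv.subRight f) (gk (l + 3))
    rw [h1, h2]
    norm_num
end

section
/- The optimal pebbling number of the grid graph P_n □ P_m is at least (2/13)·n·m for all n,m ≥ 5. -/
open Finset

/-! ### Geometry of the integer lattice -/

/-- Taxicab distance. -/
def zd (u v : ℤ × ℤ) : ℕ := (u.1 - v.1).natAbs + (u.2 - v.2).natAbs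

/-- Weight of a pebble at `u` seen from `v`. -/
def zW (u v : ℤ × ℤ) : ℚ := (1 / 2 : ℚ) ^ zd u v

/-- The four neighbours. -/
def nbrs (z : ℤ × ℤ) : Finset (ℤ × ℤ) :=
  {(z.1 + 1, z.2), (z.1 - 1, z.2), (z.1, z.2 + 1), (z.1, z.2 - 1)}

lemma mem_nbrs (z y : ℤ × ℤ) : y ∈ nbrs z ↔ zd z y = 1 := by
  obtain ⟨a, b⟩ := z
  obtain ⟨c, d⟩ := y
  simp only [nbrs, zd, Finset.mem_insert, Finset.mem_singleton, Prod.mk.injEq]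
  omega

lemma zd_comm (u v : ℤ × ℤ) : zd u v = zd v u := by
  simp only [zd]; omega

lemma nbrs_symm {z y : ℤ × ℤ} (h : y ∈ nbrs z) : z ∈ nbrs y := by
  rw [mem_nbrs] at *; rw [zd_comm]; exact h

lemma card_nbrs (z : ℤ × ℤ) : (nbrs z).card ≤ 4 := by
  unfold nbrs; exact Finset.card_le_four

lemma zW_pos (u v : ℤ × ℤ) : 0 < zW u v := by unfold zW; positivity

lemma zW_le_of_zd (u v v' : ℤ × ℤ) (k : ℕ) (h : zd u v ≤ zd u v' + k) :
    zW u v' ≤ 2 ^ k * zW u v := by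
  unfold zW
  have h1 : (1 / 2 : ℚ) ^ (zd u v' + k) ≤ (1 / 2) ^ zd u v :=
    pow_le_pow_of_le_one (by norm_num) (by norm_num) h
  rw [pow_add] at h1
  have h2 : (2 : ℚ) ^ k * (1 / 2) ^ k = 1 := by rw [← mul_pow]; norm_num
  have h3 : (0 : ℚ) < 2 ^ k := by positivity
  calc (1 / 2 : ℚ) ^ zd u v' = 2 ^ k * ((1 / 2) ^ zd u v' * (1 / 2) ^ k) := by
        rw [mul_comm ((1 / 2 : ℚ) ^ zd u v'), ← mul_assoc, h2, one_mul]
    _ ≤ _ := mul_le_mul_of_nonneg_left h1 h3.le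

lemma line_sum_aux (a : ℤ) (N : ℕ) :
    ∑ i ∈ Finset.Icc (a - N) (a + N), (1 / 2 : ℚ) ^ (a - i).natAbs
      = 3 - 2 * (1 / 2) ^ N := by
  induction N with
  | zero => simp; norm_num
  | succ k ih =>
    have h : Finset.Icc (a - ((k + 1 : ℕ) : ℤ)) (a + ((k + 1 : ℕ) : ℤ))
        = insert (a - (k + 1)) (insert (a + (k + 1)) (Finset.Icc (a - k) (a + k))) := by
      ext x; simp only [Finset.mem_Icc, Finset.mem_insert]; omega
    rw [h, Finset.sum_insert, Finset.sum_insert, ih]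
    · have e1 : (a - (a - (k + 1 : ℤ))).natAbs = k + 1 := by omega
      have e2 : (a - (a + (k + 1 : ℤ))).natAbs = k + 1 := by omega
      rw [e1, e2, pow_succ]; ring
    · simp only [Finset.mem_Icc]; omega
    · simp only [Finset.mem_Icc, Finset.mem_insert]; omega

lemma line_sum (a : ℤ) (F : Finset ℤ) : ∑ i ∈ F, (1 / 2 : ℚ) ^ (a - i).natAbs ≤ 3 := by
  obtain ⟨N, hN⟩ : ∃ N : ℕ, ∀ i ∈ F, (a - i).natAbs ≤ N :=
    ⟨F.sup fun i => (a - i).natAbs, fun i hi => Finset.le_sup (f := fun i => (a - i).natAbs) hi⟩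
  have hsub : F ⊆ Finset.Icc (a - N) (a + N) := by
    intro i hi
    have := hN i hi
    simp only [Finset.mem_Icc]; omega
  have h1 := Finset.sum_le_sum_of_subset_of_nonneg (f := fun i => (1 / 2 : ℚ) ^ (a - i).natAbs)
    hsub (fun _ _ _ => by positivity)
  rw [line_sum_aux] at h1
  have : (0 : ℚ) < (1 / 2) ^ N := by positivity
  linarith

lemma plane_sum (u : ℤ × ℤ) (F : Finset (ℤ × ℤ)) : ∑ z ∈ F, zW u z ≤ 9 := by
  have hsub : F ⊆ F.image Prod.fst ×ˢ F.image Prod.snd := by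
    intro z hz
    simp only [Finset.mem_product]
    exact ⟨Finset.mem_image_of_mem _ hz, Finset.mem_image_of_mem _ hz⟩
  have h1 := Finset.sum_le_sum_of_subset_of_nonneg (f := fun z => zW u z)
    hsub (fun _ _ _ => (zW_pos _ _).le)
  refine h1.trans ?_
  have h2 : ∑ z ∈ F.image Prod.fst ×ˢ F.image Prod.snd, zW u z
      = (∑ i ∈ F.image Prod.fst, (1 / 2 : ℚ) ^ (u.1 - i).natAbs)
        * ∑ j ∈ F.image Prod.snd, (1 / 2 : ℚ) ^ (u.2 - j).natAbs := by
    rw [Finset.sum_product, Finset.sum_mul_sum]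
    simp only [zW, zd, pow_add]
  rw [h2]
  have h3 := line_sum u.1 (F.image Prod.fst)
  have h4 := line_sum u.2 (F.image Prod.snd)
  have h5 : 0 ≤ ∑ j ∈ F.image Prod.snd, (1 / 2 : ℚ) ^ (u.2 - j).natAbs :=
    Finset.sum_nonneg fun _ _ => by positivity
  nlinarith

/-- Closed neighbourhood. -/
def nbhd (C : Finset (ℤ × ℤ)) : Finset (ℤ × ℤ) := C ∪ C.biUnion nbrs

lemma mem_nbhd (C : Finset (ℤ × ℤ)) (z : ℤ × ℤ) :
    z ∈ nbhd C ↔ z ∈ C ∨ ∃ c ∈ C, z ∈ nbrs c := by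
  simp [nbhd]

/-- Number of edges leaving `C`. -/
def cut (C : Finset (ℤ × ℤ)) : ℕ := ∑ c ∈ C, (nbrs c \ C).card

/-- Connectedness of a finite set of lattice points. -/
def Conn (C : Finset (ℤ × ℤ)) : Prop :=
  ∀ D ⊆ C, D.Nonempty → D ≠ C → ∃ x ∈ C, x ∉ D ∧ ∃ y ∈ D, x ∈ nbrs y

lemma cut_insert (D : Finset (ℤ × ℤ)) (x y : ℤ × ℤ) (hx : x ∉ D) (hy : y ∈ D)
    (hxy : x ∈ nbrs y) : cut (insert x D) ≤ cut D + 2 := by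
  unfold cut
  rw [Finset.sum_insert hx]
  have h1 : (nbrs x \ insert x D).card ≤ 3 := by
    have : (nbrs x \ insert x D) ⊂ nbrs x := by
      refine ⟨Finset.sdiff_subset, fun h => ?_⟩
      have := h (nbrs_symm hxy)
      simp [hy] at this
    have := Finset.card_lt_card this
    have := card_nbrs x
    omega
  have h2 : ∑ c ∈ D, (nbrs c \ insert x D).card < ∑ c ∈ D, (nbrs c \ D).card := by
    apply Finset.sum_lt_sum
    · intro c _
      exact Finset.card_le_card (Finset.sdiff_subset_sdiff le_rfl (Finset.subset_insert _ _))
    · refine ⟨y, hy, Finset.card_lt_card ⟨Finset.sdiff_subset_sdiff le_rfl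
        (Finset.subset_insert _ _), fun h => ?_⟩⟩
      have := h (Finset.mem_sdiff.2 ⟨hxy, hx⟩)
      simp at this
  omega

lemma cut_le (C : Finset (ℤ × ℤ)) (hne : C.Nonempty) (hC : Conn C) :
    cut C ≤ 2 * C.card + 2 := by
  have key : ∀ k : ℕ, 1 ≤ k → k ≤ C.card → ∃ D ⊆ C, D.card = k ∧ cut D ≤ 2 * k + 2 := by
    intro k hk
    induction k, hk using Nat.le_induction with
    | base =>
      intro _
      obtain ⟨c, hc⟩ := hne
      refine ⟨{c}, by simpa using hc, by simp, ?_⟩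
      simp only [cut, Finset.sum_singleton]
      exact (Finset.card_le_card Finset.sdiff_subset).trans (card_nbrs c)
    | succ k hk ih =>
      intro hkC
      obtain ⟨D, hD, hDk, hcut⟩ := ih (by omega)
      obtain ⟨x, hxC, hxD, y, hy, hxy⟩ := hC D hD (Finset.card_pos.1 (by omega))
        (by rintro rfl; omega)
      refine ⟨insert x D, Finset.insert_subset hxC hD, by rw [Finset.card_insert_of_notMem hxD, hDk],
        ?_⟩
      have := cut_insert D x y hxD hy hxy
      omega
  obtain ⟨D, hD, hDk, hcut⟩ := key C.card (Finset.card_pos.2 hne) le_rfl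
  rw [Finset.eq_of_subset_of_card_le hD hDk.ge] at hcut
  exact hcut

lemma boundary_count (C N1 : Finset (ℤ × ℤ)) (hN1 : N1 = nbhd C \ C) :
    2 * N1.card ≤ cut C + (N1.filter fun v => (C.filter fun c => v ∈ nbrs c).card = 1).card ∧
    N1.card ≤ cut C := by
  classical
  have h1 := Finset.sum_card_bipartiteAbove_eq_sum_card_bipartiteBelow
    (s := N1) (t := C) (fun v c => v ∈ nbrs c)
  have h2 : ∑ c ∈ C, (Finset.bipartiteBelow (fun v c => v ∈ nbrs c) N1 c).card ≤ cut C := by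
    refine Finset.sum_le_sum fun c _ => Finset.card_le_card fun v hv => ?_
    simp only [Finset.mem_bipartiteBelow, hN1, Finset.mem_sdiff] at hv
    exact Finset.mem_sdiff.2 ⟨hv.2, hv.1.2⟩
  rw [← h1] at h2
  have hpos : ∀ v ∈ N1, 1 ≤ (C.filter fun c => v ∈ nbrs c).card := by
    intro v hv
    rw [hN1, Finset.mem_sdiff, mem_nbhd] at hv
    obtain ⟨h | ⟨c, hc, hvc⟩, hn⟩ := hv
    · exact absurd h hn
    · exact Finset.card_pos.2 ⟨c, Finset.mem_filter.2 ⟨hc, hvc⟩⟩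
  constructor
  · have h3 : ∑ v ∈ N1, 2 ≤ ∑ v ∈ N1, ((C.filter fun c => v ∈ nbrs c).card
        + if (C.filter fun c => v ∈ nbrs c).card = 1 then 1 else 0) := by
      refine Finset.sum_le_sum fun v hv => ?_
      have := hpos v hv
      split_ifs <;> omega
    rw [Finset.sum_add_distrib, Finset.sum_const, smul_eq_mul] at h3
    rw [Finset.card_filter]
    simp only [Finset.bipartiteAbove] at h2
    omega
  · have h3 : ∑ v ∈ N1, 1 ≤ ∑ v ∈ N1, (C.filter fun c => v ∈ nbrs c).card :=
      Finset.sum_le_sum hpos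
    rw [Finset.sum_const, smul_eq_mul] at h3
    simp only [Finset.bipartiteAbove] at h2
    omega

/-- The opposite of `c` with respect to `v`. -/
def opp (c v : ℤ × ℤ) : ℤ × ℤ := (2 * v.1 - c.1, 2 * v.2 - c.2)

lemma zd_cases (u c v c' : ℤ × ℤ) (hv : v ∈ nbrs c) (h : opp c v ∈ nbrs c') (hne : c' ≠ v) :
    (zd u v = zd u c + 1 ∧ zd u v ≤ zd u c') ∨ (zd u c = zd u v + 1 ∧ zd u v ≤ zd u c' + 2) := by
  obtain ⟨u1, u2⟩ := u
  obtain ⟨a, b⟩ := c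
  obtain ⟨x, y⟩ := v
  obtain ⟨p, q⟩ := c'
  simp only [nbrs, opp, zd, Finset.mem_insert, Finset.mem_singleton, Prod.mk.injEq, ne_eq] at *
  rcases hv with hv | hv | hv | hv <;> rcases h with h | h | h | h <;> omega

lemma zW_ineq (u c v c' : ℤ × ℤ) (hv : v ∈ nbrs c) (h : opp c v ∈ nbrs c') (hne : c' ≠ v) :
    2 / 5 * zW u c + 1 / 5 * zW u c' ≤ zW u v := by
  have hp := zW_pos u v
  rcases zd_cases u c v c' hv h hne with ⟨h1, h2⟩ | ⟨h1, h2⟩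
  · have e1 := zW_le_of_zd u v c 1 (by omega)
    have e2 := zW_le_of_zd u v c' 0 (by omega)
    norm_num at e1 e2
    linarith
  · have e1 : zW u c = 1 / 2 * zW u v := by
      unfold zW; rw [h1, pow_succ]; ring
    have e2 := zW_le_of_zd u v c' 2 (by omega)
    norm_num at e2
    linarith

lemma opp_far (u c v : ℤ × ℤ) (hv : v ∈ nbrs c) : zW u c ≤ 4 * zW u (opp c v) := by
  have := zW_le_of_zd u (opp c v) c 2 (by
    rw [mem_nbrs] at hv
    simp only [zd, opp] at *
    omega)
  norm_num at this
  exact this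

lemma opp_nbr (c v : ℤ × ℤ) (hv : v ∈ nbrs c) : v ∈ nbrs (opp c v) := by
  rw [mem_nbrs] at *
  simp only [zd, opp] at *
  omega

lemma opp_ne (c v : ℤ × ℤ) (hv : v ∈ nbrs c) : opp c v ≠ c := by
  obtain ⟨a, b⟩ := c
  obtain ⟨x, y⟩ := v
  rw [mem_nbrs] at *
  simp only [zd, opp, ne_eq, Prod.mk.injEq] at *
  omega

lemma zW_two (u v v' : ℤ × ℤ) (h : v ≠ v') : zW u v + zW u v' ≤ 3 / 2 := by
  have h0 : ∀ v, zW u v ≤ 1 := fun v => pow_le_one₀ (by norm_num) (by norm_num)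
  have h1 : ∀ v, zd u v ≠ 0 → zW u v ≤ 1 / 2 := fun v hv => by
    unfold zW
    calc (1 / 2 : ℚ) ^ zd u v ≤ (1 / 2) ^ 1 :=
          pow_le_pow_of_le_one (by norm_num) (by norm_num) (by omega)
      _ = 1 / 2 := by norm_num
  by_cases hv : zd u v = 0
  · have : zd u v' ≠ 0 := by
      obtain ⟨a, b⟩ := v
      obtain ⟨x, y⟩ := v'
      simp only [zd, ne_eq, Prod.mk.injEq] at *
      omega
    linarith [h0 v, h1 v' this]
  · linarith [h0 v', h1 v hv]

lemma final_arith (c n b x1 x2 z t : ℕ) (sc sz sn : ℚ) (hZ : x2 ≤ 4 * z) (hX : x1 + x2 = b)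
    (h3 : 2 * n ≤ 2 * c + 2 + b) (h4 : b ≤ 2 * c + 2) (h5 : 6 ≤ c)
    (s1 : (c : ℚ) * 2 ≤ sc) (s2 : (z : ℚ) * (1 / 2) ≤ sz) (s3 : (n : ℚ) + x1 * (1 / 5) ≤ sn)
    (hsum : sc + sn + sz ≤ 9 * t) : 2 * (c + n) ≤ 13 * t := by
  have q1 : (x2 : ℚ) ≤ 4 * z := by exact_mod_cast hZ
  have q2 : (x1 : ℚ) + x2 = b := by exact_mod_cast hX
  have q3 : 2 * (n : ℚ) ≤ 2 * c + 2 + b := by exact_mod_cast h3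
  have q4 : (b : ℚ) ≤ 2 * c + 2 := by exact_mod_cast h4
  have q5 : (6 : ℚ) ≤ c := by exact_mod_cast h5
  have q6 : (0 : ℚ) ≤ x1 := by positivity
  have : 2 * ((c : ℚ) + n) ≤ 13 * t := by linarith
  exact_mod_cast this

set_option maxHeartbeats 1000000 in
/-- Main local estimate. -/
lemma local_bound {ι : Type*} (I : Finset ι) (f : ι → ℤ × ℤ) (a : ι → ℕ)
    (C : Finset (ℤ × ℤ)) (hne : C.Nonempty) (hC : Conn C)
    (hw : ∀ z ∈ C, (2 : ℚ) ≤ ∑ x ∈ I, (a x : ℚ) * zW (f x) z) :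
    2 * (nbhd C).card ≤ 13 * ∑ x ∈ I, a x := by
  classical
  set w : ℤ × ℤ → ℚ := fun z => ∑ x ∈ I, (a x : ℚ) * zW (f x) z with hwdef
  set t : ℕ := ∑ x ∈ I, a x with ht
  have hwt : ∀ F : Finset (ℤ × ℤ), ∑ z ∈ F, w z ≤ 9 * t := by
    intro F
    simp only [hwdef]
    rw [Finset.sum_comm, ht, Nat.cast_sum, Finset.mul_sum]
    refine Finset.sum_le_sum fun x _ => ?_
    rw [← Finset.mul_sum, mul_comm (9 : ℚ)]
    exact mul_le_mul_of_nonneg_left (plane_sum _ _) (by positivity)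
  -- the number of pebbles is at least two, and at least three if there are two points
  have ht2 : 2 ≤ t := by
    obtain ⟨c, hc⟩ := hne
    have h1 : w c ≤ t := by
      simp only [hwdef, ht, Nat.cast_sum]
      refine Finset.sum_le_sum fun x _ => ?_
      have : zW (f x) c ≤ 1 := pow_le_one₀ (by norm_num) (by norm_num)
      have h0 : (0 : ℚ) ≤ a x := by positivity
      nlinarith
    have := (hw c hc).trans h1
    exact_mod_cast this
  have ht3 : 2 ≤ C.card → 3 ≤ t := by
    intro h
    obtain ⟨v, hv, v', hv', hvv⟩ := Finset.one_lt_card.1 (show 1 < C.card by omega)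
    have h1 : w v + w v' ≤ 3 / 2 * t := by
      simp only [hwdef, ht, Nat.cast_sum]
      rw [← Finset.sum_add_distrib, Finset.mul_sum]
      refine Finset.sum_le_sum fun x _ => ?_
      have := zW_two (f x) v v' hvv
      have h0 : (0 : ℚ) ≤ a x := by positivity
      nlinarith
    have h2 := hw v hv
    have h3 := hw v' hv'
    by_contra hlt
    have : t ≤ 2 := by omega
    have : (t : ℚ) ≤ 2 := by exact_mod_cast this
    have h2' : 2 ≤ w v := h2
    have h3' : 2 ≤ w v' := h3
    linarith
  set N1 := nbhd C \ C with hN1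
  set B1 := N1.filter fun v => (C.filter fun c => v ∈ nbrs c).card = 1 with hB1
  have hCsub : C ⊆ nbhd C := Finset.subset_union_left
  have hcard : (nbhd C).card = C.card + N1.card := by
    rw [hN1, Finset.card_sdiff_of_subset hCsub]
    have := Finset.card_le_card hCsub
    omega
  have hbb := boundary_count C N1 hN1
  have hb : 2 * N1.card ≤ cut C + B1.card := hbb.1
  have hb' : N1.card ≤ cut C := hbb.2
  clear hbb
  have hcut := cut_le C hne hC
  have hB1N : B1.card ≤ N1.card := Finset.card_filter_le _ _
  have hCpos := Finset.card_pos.2 hne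
  rcases Nat.lt_or_ge C.card 6 with hs | hs
  · rcases Nat.lt_or_ge C.card 2 with h | h
    · omega
    · have := ht3 h
      omega
  -- the large case
  have hex : ∀ v, ∃ c, v ∈ B1 → (c ∈ C ∧ v ∈ nbrs c ∧ ∀ c' ∈ C, v ∈ nbrs c' → c' = c) := by
    intro v
    by_cases hv : v ∈ B1
    · have := (Finset.mem_filter.1 hv).2
      obtain ⟨c, hc⟩ := Finset.card_eq_one.1 this
      have hcm : c ∈ C.filter fun c => v ∈ nbrs c := by rw [hc]; simp
      refine ⟨c, fun _ => ⟨(Finset.mem_filter.1 hcm).1, (Finset.mem_filter.1 hcm).2,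
        fun c' h1 h2 => ?_⟩⟩
      have : c' ∈ C.filter fun c => v ∈ nbrs c := Finset.mem_filter.2 ⟨h1, h2⟩
      rw [hc] at this
      simpa using this
    · exact ⟨v, fun h => absurd h hv⟩
  choose g hg using hex
  set X1 := B1.filter fun v => opp (g v) v ∈ nbhd C with hX1
  set X2 := B1.filter fun v => ¬ opp (g v) v ∈ nbhd C with hX2
  have hX : X1.card + X2.card = B1.card := Finset.card_filter_add_card_filter_not _
  set Z := X2.image fun v => opp (g v) v with hZ
  have hZcard : X2.card ≤ 4 * Z.card := by
    rw [hZ]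
    refine Finset.card_le_mul_card_image X2 4 fun z _ => ?_
    refine (Finset.card_le_card (t := nbrs z) fun v hv => ?_).trans (card_nbrs z)
    obtain ⟨h1, rfl⟩ := Finset.mem_filter.1 hv
    exact opp_nbr _ _ (hg v (Finset.mem_filter.1 h1).1).2.1
  have hZw : ∀ z ∈ Z, (1 / 2 : ℚ) ≤ w z := by
    intro z hz
    obtain ⟨v, hv, rfl⟩ := Finset.mem_image.1 hz
    obtain ⟨h1, h2, -⟩ := hg v (Finset.mem_filter.1 hv).1
    have h3 : w (g v) ≤ 4 * w (opp (g v) v) := by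
      simp only [hwdef]
      rw [Finset.mul_sum]
      refine Finset.sum_le_sum fun x _ => ?_
      have := opp_far (f x) (g v) v h2
      have h0 : (0 : ℚ) ≤ a x := by positivity
      nlinarith
    have h4 : 2 ≤ w (g v) := hw _ h1
    linarith
  have hN1w : ∀ z ∈ N1, (1 : ℚ) ≤ w z := by
    intro z hz
    rw [hN1, Finset.mem_sdiff, mem_nbhd] at hz
    obtain ⟨h | ⟨c, hc, hzc⟩, hn⟩ := hz
    · exact absurd h hn
    have h3 : w c ≤ 2 * w z := by
      simp only [hwdef]
      rw [Finset.mul_sum]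
      refine Finset.sum_le_sum fun x _ => ?_
      have := zW_le_of_zd (f x) z c 1 (by
        rw [mem_nbrs] at hzc
        simp only [zd] at *
        omega)
      have h0 : (0 : ℚ) ≤ a x := by positivity
      nlinarith
    have h4 : 2 ≤ w c := hw _ hc
    linarith
  have hX1w : ∀ z ∈ X1, (6 / 5 : ℚ) ≤ w z := by
    intro v hv
    obtain ⟨hvB, hvo⟩ := Finset.mem_filter.1 hv
    obtain ⟨h1, h2, h3⟩ := hg v hvB
    have hvC : v ∉ C := (Finset.mem_sdiff.1 (Finset.mem_filter.1 hvB).1).2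
    rw [mem_nbhd] at hvo
    rcases hvo with hvo | ⟨c', hc', hvo⟩
    · exact absurd (h3 _ hvo (opp_nbr _ _ h2)) (opp_ne _ _ h2)
    have hne' : c' ≠ v := by rintro rfl; exact hvC hc'
    have h5 : 2 / 5 * w (g v) + 1 / 5 * w c' ≤ w v := by
      simp only [hwdef]
      rw [Finset.mul_sum, Finset.mul_sum, ← Finset.sum_add_distrib]
      refine Finset.sum_le_sum fun x _ => ?_
      have := zW_ineq (f x) (g v) v c' h2 hvo hne'
      have h0 : (0 : ℚ) ≤ a x := by positivity
      nlinarith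
    have h6 : 2 ≤ w (g v) := hw _ h1
    have h7 : 2 ≤ w c' := hw _ hc'
    linarith
  have hd1 : Disjoint C N1 := Finset.disjoint_sdiff
  have hd2 : Disjoint (C ∪ N1) Z := by
    rw [hN1, Finset.union_sdiff_of_subset hCsub, Finset.disjoint_right]
    intro z hz
    obtain ⟨v, hv, rfl⟩ := Finset.mem_image.1 hz
    exact (Finset.mem_filter.1 hv).2
  have hsum := hwt ((C ∪ N1) ∪ Z)
  rw [Finset.sum_union hd2, Finset.sum_union hd1] at hsum
  have s1 : (C.card : ℚ) * 2 ≤ ∑ z ∈ C, w z := by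
    rw [← nsmul_eq_mul]; exact Finset.card_nsmul_le_sum _ _ _ hw
  have s2 : (Z.card : ℚ) * (1 / 2) ≤ ∑ z ∈ Z, w z := by
    rw [← nsmul_eq_mul]; exact Finset.card_nsmul_le_sum _ _ _ hZw
  have s3 : (N1.card : ℚ) + X1.card * (1 / 5) ≤ ∑ z ∈ N1, w z := by
    have hX1N : X1 ⊆ N1 := (Finset.filter_subset _ _).trans (Finset.filter_subset _ _)
    rw [← Finset.sum_sdiff hX1N]
    have e1 : ((N1 \ X1).card : ℚ) * 1 ≤ ∑ z ∈ N1 \ X1, w z := by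
      rw [← nsmul_eq_mul]
      exact Finset.card_nsmul_le_sum _ _ _ fun z hz => hN1w z (Finset.mem_sdiff.1 hz).1
    have e2 : (X1.card : ℚ) * (6 / 5) ≤ ∑ z ∈ X1, w z := by
      rw [← nsmul_eq_mul]; exact Finset.card_nsmul_le_sum _ _ _ hX1w
    have e3 : (N1 \ X1).card + X1.card = N1.card :=
      Finset.card_sdiff_add_card_eq_card hX1N
    have e3' : ((N1 \ X1).card : ℚ) + X1.card = N1.card := by exact_mod_cast e3
    linarith
  rw [hcard]
  exact final_arith C.card N1.card B1.card X1.card X2.card Z.card t _ _ _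
    hZcard hX (by omega) (by omega) hs s1 s2 s3 hsum

lemma nbhd_union (A B : Finset (ℤ × ℤ)) : nbhd (A ∪ B) ⊆ nbhd A ∪ nbhd B := by
  intro z hz
  rw [Finset.mem_union, mem_nbhd, mem_nbhd]
  rw [mem_nbhd] at hz
  rcases hz with h | ⟨c, hc, h⟩
  · rcases Finset.mem_union.1 h with h | h
    · exact Or.inl (Or.inl h)
    · exact Or.inr (Or.inl h)
  · rcases Finset.mem_union.1 hc with hc | hc
    · exact Or.inl (Or.inr ⟨c, hc, h⟩)
    · exact Or.inr (Or.inr ⟨c, hc, h⟩)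

/-- Decomposition into connected pieces. -/
lemma pieces {V : Type*} [DecidableEq V] (f : V → ℤ × ℤ) (p : V → ℕ) (S : Finset V)
    (hw : ∀ T ⊆ S, (∀ x ∈ T, ∀ y ∈ S, f x ∈ nbrs (f y) → y ∈ T) →
      ∀ z ∈ T, (2 : ℚ) ≤ ∑ x ∈ T, (p x : ℚ) * zW (f x) (f z)) (k : ℕ) :
    ∀ T ⊆ S, T.card ≤ k → (∀ x ∈ T, ∀ y ∈ S, f x ∈ nbrs (f y) → y ∈ T) →
      2 * (nbhd (T.image f)).card ≤ 13 * ∑ x ∈ T, p x := by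
  induction k with
  | zero =>
    intro T _ hT _
    have : T = ∅ := by simpa using hT
    subst this
    simp [nbhd]
  | succ k ih =>
    intro T hTS hT hcl
    rcases T.eq_empty_or_nonempty with rfl | hne
    · simp [nbhd]
    by_cases hconn : Conn (T.image f)
    · refine local_bound T f p (T.image f) (hne.image f) hconn fun z hz => ?_
      obtain ⟨y, hy, rfl⟩ := Finset.mem_image.1 hz
      exact hw T hTS hcl y hy
    unfold Conn at hconn
    push Not at hconn
    obtain ⟨D, hD, hDne, hDC, hno⟩ := hconn
    set A := T.filter fun x => f x ∈ D with hA
    set B := T.filter fun x => ¬ f x ∈ D with hB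
    have hAB : A.card + B.card = T.card := Finset.card_filter_add_card_filter_not _
    have hsum : ∑ x ∈ A, p x + ∑ x ∈ B, p x = ∑ x ∈ T, p x :=
      Finset.sum_filter_add_sum_filter_not _ _ _
    have hApos : 0 < A.card := by
      obtain ⟨d, hd⟩ := hDne
      obtain ⟨x, hx, rfl⟩ := Finset.mem_image.1 (hD hd)
      exact Finset.card_pos.2 ⟨x, Finset.mem_filter.2 ⟨hx, hd⟩⟩
    have hBpos : 0 < B.card := by
      by_contra h
      apply hDC
      refine Finset.Subset.antisymm hD fun z hz => ?_
      obtain ⟨x, hx, rfl⟩ := Finset.mem_image.1 hz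
      by_contra hxD
      exact h (Finset.card_pos.2 ⟨x, Finset.mem_filter.2 ⟨hx, hxD⟩⟩)
    have hA' := ih A ((Finset.filter_subset _ _).trans hTS) (by omega) (by
      intro x hx y hy hxy
      obtain ⟨hxT, hxD⟩ := Finset.mem_filter.1 hx
      have hyT := hcl x hxT y hy hxy
      refine Finset.mem_filter.2 ⟨hyT, ?_⟩
      by_contra hyD
      exact hno (f y) (Finset.mem_image_of_mem f hyT) hyD (f x) hxD (nbrs_symm hxy))
    have hB' := ih B ((Finset.filter_subset _ _).trans hTS) (by omega) (by
      intro x hx y hy hxy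
      obtain ⟨hxT, hxD⟩ := Finset.mem_filter.1 hx
      have hyT := hcl x hxT y hy hxy
      refine Finset.mem_filter.2 ⟨hyT, ?_⟩
      intro hyD
      exact hno (f x) (Finset.mem_image_of_mem f hxT) hxD (f y) hyD hxy)
    have hTAB : T.image f = A.image f ∪ B.image f := by
      rw [← Finset.image_union, hA, hB, Finset.filter_union_filter_not_eq]
    have h1 := Finset.card_le_card (nbhd_union (A.image f) (B.image f))
    have h2 := Finset.card_union_le (nbhd (A.image f)) (nbhd (B.image f))
    rw [hTAB]
    omega

/-! ### Pebbling -/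

lemma kreach_step {V : Type*} [DecidableEq V] (G : SimpleGraph V) (q : V → ℕ) (mv : PMove V)
    (h1 : G.Adj mv.src mv.tgt) (h2 : 2 ≤ q mv.src) (k : ℕ) (v : V)
    (h : KReachable G (applyMove q mv) k v) : KReachable G q k v := by
  obtain ⟨σ, hσ, hk⟩ := h
  exact ⟨mv :: σ, ⟨h1, h2, hσ⟩, hk⟩

lemma potential {V : Type*} [DecidableEq V] (G : SimpleGraph V) (f : V → ℤ × ℤ)
    (hf : ∀ x y, G.Adj x y → f x ∈ nbrs (f y)) (S T : Finset V)
    (hcl : ∀ x ∈ T, ∀ y ∈ S, f x ∈ nbrs (f y) → y ∈ T) (z : ℤ × ℤ) (σ : List (PMove V)) :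
    ∀ q : V → ℕ, (∀ v, KReachable G q 2 v → v ∈ S) → Executable G q σ →
      ∑ x ∈ T, (applySeq q σ x : ℚ) * zW (f x) z ≤ ∑ x ∈ T, (q x : ℚ) * zW (f x) z := by
  induction σ with
  | nil => intro q _ _; simp [applySeq]
  | cons mv σ ih =>
    intro q hS hex
    obtain ⟨hadj, h2, hex'⟩ := hex
    have hstep := ih (applyMove q mv)
      (fun v hv => hS v (kreach_step G q mv hadj h2 2 v hv)) hex'
    have e : applySeq q (mv :: σ) = applySeq (applyMove q mv) σ := rfl
    rw [e]
    refine hstep.trans ?_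
    have hsrc : mv.src ∈ S := hS _ ⟨[], trivial, h2⟩
    have hne : mv.src ≠ mv.tgt := hadj.ne
    have hval : ∀ x, (applyMove q mv x : ℚ) * zW (f x) z = (q x : ℚ) * zW (f x) z
        + ((if x = mv.tgt then zW (f x) z else 0) - (if x = mv.src then 2 * zW (f x) z else 0)) := by
      intro x
      unfold applyMove
      by_cases hx : x = mv.src
      · subst hx
        rw [if_pos rfl, if_neg hne, if_pos rfl, Nat.cast_sub h2]
        push_cast; ring
      · rw [if_neg hx, if_neg hx]
        split_ifs
        · push_cast; ring
        · ring
    rw [Finset.sum_congr rfl fun x _ => hval x, Finset.sum_add_distrib, Finset.sum_sub_distrib,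
      Finset.sum_ite_eq', Finset.sum_ite_eq']
    have hW : zW (f mv.tgt) z ≤ 2 * zW (f mv.src) z := by
      have hn := hf _ _ hadj
      rw [mem_nbrs] at hn
      unfold zW
      have := zW_le_of_zd z (f mv.src) (f mv.tgt) 1 (by
        simp only [zd] at *
        omega)
      unfold zW at this
      rw [zd_comm z, zd_comm z] at this
      simpa using this
    have hp := zW_pos (f mv.src) z
    by_cases ht : mv.tgt ∈ T
    · have hs : mv.src ∈ T := hcl _ ht _ hsrc (hf _ _ hadj.symm)
      rw [if_pos ht, if_pos hs]
      linarith
    · rw [if_neg ht]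
      split_ifs <;> linarith

lemma covered {V : Type*} [DecidableEq V] (G : SimpleGraph V) (v : V) (σ : List (PMove V)) :
    ∀ q : V → ℕ, Executable G q σ → 1 ≤ applySeq q σ v →
      1 ≤ q v ∨ ∃ x, G.Adj x v ∧ KReachable G q 2 x := by
  induction σ with
  | nil => intro q _ h; exact Or.inl h
  | cons mv σ ih =>
    intro q hex h
    obtain ⟨hadj, h2, hex'⟩ := hex
    rcases ih (applyMove q mv) hex' h with h1 | ⟨x, hx, hk⟩
    · by_cases hv : v = mv.tgt
      · subst hv
        exact Or.inr ⟨mv.src, hadj, [], trivial, h2⟩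
      · left
        unfold applyMove at h1
        rw [if_neg hv] at h1
        split_ifs at h1 <;> omega
    · exact Or.inr ⟨x, hx, kreach_step G q mv hadj h2 2 x hk⟩

lemma solvable_bound {V : Type*} [Fintype V] [DecidableEq V] (G : SimpleGraph V)
    (f : V → ℤ × ℤ) (hinj : Function.Injective f)
    (hf : ∀ x y, G.Adj x y → f x ∈ nbrs (f y)) (p : V → ℕ) (hp : Solvable G p) :
    2 * Fintype.card V ≤ 13 * ∑ v, p v := by
  classical
  set S : Finset V := Finset.univ.filter fun v => KReachable G p 2 v with hS
  have hmem : ∀ v, KReachable G p 2 v → v ∈ S := fun v hv => by simp [hS, hv]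
  have hpc := pieces f p S (by
    intro T hTS hcl z hz
    obtain ⟨σ, hσ, h2⟩ := (Finset.mem_filter.1 (hTS hz)).2
    have h1 := potential G f hf S T hcl (f z) σ p hmem hσ
    refine le_trans ?_ h1
    have h3 := Finset.single_le_sum (f := fun x => (applySeq p σ x : ℚ) * zW (f x) (f z))
      (fun x _ => mul_nonneg (by positivity) (zW_pos _ _).le) hz
    have h4 : zW (f z) (f z) = 1 := by simp [zW, zd]
    simp only [h4, mul_one] at h3
    have h5 : (2 : ℚ) ≤ applySeq p σ z := by exact_mod_cast h2
    exact h5.trans h3) S.card S le_rfl le_rfl (fun _ _ y hy _ => hy)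
  set R : Finset V := Finset.univ.filter fun v => f v ∉ nbhd (S.image f) with hR
  set M : Finset V := Finset.univ.filter fun v => f v ∈ nbhd (S.image f) with hM
  have hMR : M.card + R.card = Fintype.card V := Finset.card_filter_add_card_filter_not _
  have hMc : M.card ≤ (nbhd (S.image f)).card := by
    rw [← Finset.card_image_of_injective M hinj]
    refine Finset.card_le_card fun z hz => ?_
    obtain ⟨x, hx, rfl⟩ := Finset.mem_image.1 hz
    exact (Finset.mem_filter.1 hx).2
  have hRp : R.card ≤ ∑ v ∈ R, p v := by
    rw [Finset.card_eq_sum_ones]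
    refine Finset.sum_le_sum fun v hv => ?_
    obtain ⟨σ, hσ, h1⟩ := hp v
    rcases covered G v σ p hσ h1 with h | ⟨x, hx, hk⟩
    · exact h
    · exfalso
      apply (Finset.mem_filter.1 hv).2
      rw [mem_nbhd]
      exact Or.inr ⟨f x, Finset.mem_image_of_mem f (hmem x hk), hf _ _ hx.symm⟩
  have hdis : Disjoint S R := by
    rw [Finset.disjoint_right]
    intro v hv hvS
    apply (Finset.mem_filter.1 hv).2
    rw [mem_nbhd]
    exact Or.inl (Finset.mem_image_of_mem f hvS)
  have hsum : ∑ v ∈ S, p v + ∑ v ∈ R, p v ≤ ∑ v, p v := by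
    rw [← Finset.sum_union hdis]
    exact Finset.sum_le_sum_of_subset (Finset.subset_univ _)
  omega

/-- `π_opt(P_n □ P_m) ≥ (2/13)·n·m` for all `n, m ≥ 5`. -/
theorem stmt18 (n m : ℕ) (hn : 5 ≤ n) (hm : 5 ≤ m) :
    (2 / 13 : ℚ) * n * m
      ≤ (piOpt ((SimpleGraph.pathGraph n).boxProd (SimpleGraph.pathGraph m)) : ℚ) := by
  set G := (SimpleGraph.pathGraph n).boxProd (SimpleGraph.pathGraph m) with hG
  have hne : {k | ∃ p : Fin n × Fin m → ℕ, Solvable G p ∧ ∑ v, p v = k}.Nonempty :=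
    ⟨_, fun _ => 1, fun v => ⟨[], trivial, le_rfl⟩, rfl⟩
  obtain ⟨p, hp, hk⟩ := Nat.sInf_mem hne
  have hb := solvable_bound G (fun x => (((x.1 : ℕ) : ℤ), ((x.2 : ℕ) : ℤ)))
    (by
      rintro ⟨a, b⟩ ⟨c, d⟩ h
      simp only [Prod.mk.injEq, Nat.cast_inj] at h
      exact Prod.ext (Fin.ext h.1) (Fin.ext h.2))
    (by
      rintro ⟨a, b⟩ ⟨c, d⟩ h
      rw [mem_nbrs]
      rw [hG, SimpleGraph.boxProd_adj, SimpleGraph.pathGraph_adj, SimpleGraph.pathGraph_adj] at h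
      simp only [zd, Fin.ext_iff] at *
      omega) p hp
  rw [Fintype.card_prod, Fintype.card_fin, Fintype.card_fin, hk] at hb
  have hb' : 2 * (n * m) ≤ 13 * piOpt G := hb
  have hq : (2 : ℚ) * (n * m) ≤ 13 * (piOpt G : ℚ) := by exact_mod_cast hb'
  linarith
end

section
/- For all integers k ≥ 0 and 0 ≤ r ≤ 2 with 3k+r ≥ 1, the optimal pebbling numbers of the path and cycle on 3k+r vertices satisfy π_opt(P_{3k+r}) = π_opt(C_{3k+r}) = 2k + r, i.e., π_opt(P_n) = π_opt(C_n) = ⌈2n/3⌉. -/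
open Finset

section Helpers

variable {V : Type*}

/-- A supersolution of the one-directional flow recursion along a permutation. -/
def SuperSol (s : Equiv.Perm V) (p R : V → ℕ) : Prop :=
  ∀ i, p (s i) + R i / 2 ≤ R (s i)

/-- Single-move preservation of a vertex being blocked, in both directions. -/
theorem step_fwd [DecidableEq V] (s : Equiv.Perm V) (p R L : V → ℕ) (v a b : V)
    (hab : a ≠ b) (hb : b = s a) (h2 : 2 ≤ p a)
    (hR : SuperSol s p R) (hL : SuperSol s.symm p L) (hRv : R v = 0) (hLv : L v = 0) :
    ∃ R' L' : V → ℕ, SuperSol s (applyMove p ⟨a, b⟩) R' ∧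
      SuperSol s.symm (applyMove p ⟨a, b⟩) L' ∧ R' v = 0 ∧ L' v = 0 := by
  have hR' : ∀ j, p j + R (s.symm j) / 2 ≤ R j := fun j => by
    have := hR (s.symm j); simpa using this
  have hL' : ∀ j, p j + L (s j) / 2 ≤ L j := fun j => by
    have := hL (s j); simpa using this
  have hRa := hR' a
  have hLa := hL' a
  have hRb := hR' b
  have hLb := hL' b
  have hsb : s.symm b = a := by rw [hb]; simp
  rw [hsb] at hRb
  rw [← hb] at hLa
  have hva : v ≠ a := by rintro rfl; omega
  have hvb : v ≠ b := by rintro rfl; omega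
  refine ⟨fun w => if w = a then R w - 2 else R w,
    fun w => if w = a then L w - 1 else if w = b then L w + 1 else L w, ?_, ?_, ?_, ?_⟩
  · intro i
    have key : ∀ j, applyMove p ⟨a, b⟩ j + (if s.symm j = a then R (s.symm j) - 2
        else R (s.symm j)) / 2 ≤ (if j = a then R j - 2 else R j) := by
      intro j
      have hj := hR' j
      by_cases h1 : j = a
      · subst h1
        simp only [applyMove, if_true]
        split_ifs <;> omega
      · by_cases h3 : j = b
        · subst h3
          rw [hsb]
          simp only [applyMove, if_true, if_neg h1]
          omega
        · simp only [applyMove, if_neg h1, if_neg h3]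
          split_ifs <;> omega
    have := key (s i)
    simpa using this
  · intro i
    have key : ∀ j, applyMove p ⟨a, b⟩ j + (if s j = a then L (s j) - 1
        else if s j = b then L (s j) + 1 else L (s j)) / 2 ≤
        (if j = a then L j - 1 else if j = b then L j + 1 else L j) := by
      intro j
      have hj := hL' j
      by_cases h1 : j = a
      · subst h1
        rw [← hb]
        simp only [applyMove, if_true, if_neg hab.symm]
        omega
      · have h4 : s j ≠ b := by
          rw [hb]; intro h; exact h1 (s.injective h)
        by_cases h3 : j = b
        · subst h3
          simp only [applyMove, if_true, if_neg h1, if_neg h4]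
          split_ifs <;> omega
        · simp only [applyMove, if_neg h1, if_neg h3, if_neg h4]
          split_ifs <;> omega
    have := key (s.symm i)
    simpa using this
  · simp [hva, hRv]
  · simp [hva, hvb, hLv]

theorem blocked [DecidableEq V] (G : SimpleGraph V) (s : Equiv.Perm V)
    (hG : ∀ a b, G.Adj a b → b = s a ∨ a = s b) (v : V) (σ : List (PMove V)) :
    ∀ p R L : V → ℕ, SuperSol s p R → SuperSol s.symm p L → R v = 0 → L v = 0 →
      Executable G p σ → applySeq p σ v = 0 := by
  induction σ with
  | nil =>
    intro p R L hR _ hRv _ _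
    have := hR (s.symm v)
    simp only [Equiv.apply_symm_apply] at this
    simp only [applySeq, List.foldl_nil]
    omega
  | cons m ms ih =>
    intro p R L hR hL hRv hLv hex
    obtain ⟨hadj, h2, hex⟩ := hex
    have : ∃ R' L' : V → ℕ, SuperSol s (applyMove p m) R' ∧
        SuperSol s.symm (applyMove p m) L' ∧ R' v = 0 ∧ L' v = 0 := by
      rcases hG _ _ hadj with h | h
      · exact step_fwd s p R L v m.src m.tgt hadj.ne h h2 hR hL hRv hLv
      · obtain ⟨L', R', h1, h2, h3, h4⟩ := step_fwd s.symm p L R v m.src m.tgt hadj.ne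
          (by rw [h]; simp) h2 hL (by simpa using hR) hLv hRv
        exact ⟨R', L', by simpa using h2, h1, h4, h3⟩
    obtain ⟨R', L', h1, h2, h3, h4⟩ := this
    exact ih _ R' L' h1 h2 h3 h4 hex

theorem exists_fixed [Fintype V] [DecidableEq V] (s : Equiv.Perm V) (p : V → ℕ) :
    ∃ R : V → ℕ, ∀ i, R (s i) = p (s i) + R i / 2 := by
  have hne : ∃ N : ℕ, ∃ R : V → ℕ, SuperSol s p R ∧ ∑ i, R i = N := by
    refine ⟨_, fun _ => 2 * ∑ i, p i, fun i => ?_, rfl⟩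
    have := Finset.single_le_sum (f := p) (fun _ _ => Nat.zero_le _) (Finset.mem_univ (s i))
    beta_reduce
    omega
  classical
  obtain ⟨R, hR, hN⟩ := Nat.find_spec hne
  refine ⟨R, fun i => ?_⟩
  by_contra hcon
  have hi := hR i
  refine Nat.find_min hne (m := ∑ j, Function.update R (s i) (R (s i) - 1) j) ?_
    ⟨_, fun j => ?_, rfl⟩
  · rw [← hN]
    apply Finset.sum_lt_sum
    · intro j _
      by_cases h : j = s i
      · subst h; simp
      · simp [h]
    · exact ⟨s i, Finset.mem_univ _, by simp; omega⟩
  · have hj := hR j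
    simp only [Function.update_apply]
    by_cases h : j = i
    · subst h
      simp only [if_true]
      split_ifs with h
      · rw [← h] at hi hcon ⊢
        omega
      · omega
    · have : s j ≠ s i := fun h' => h (s.injective h')
      rw [if_neg this]
      split_ifs with h'
      · rw [← h']; omega
      · exact hj

theorem fixed_sum [Fintype V] (s : Equiv.Perm V) (p R : V → ℕ)
    (hR : ∀ i, R (s i) = p (s i) + R i / 2) : ∑ i, R i = ∑ i, p i + ∑ i, R i / 2 := by
  rw [← Equiv.sum_comp s R, ← Equiv.sum_comp s p, ← Finset.sum_add_distrib]
  exact Finset.sum_congr rfl fun i _ => hR i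

theorem lower_bound [Fintype V] [DecidableEq V] (G : SimpleGraph V) (s : Equiv.Perm V)
    (hG : ∀ a b, G.Adj a b → b = s a ∨ a = s b) (p : V → ℕ) (hp : Solvable G p) :
    2 * Fintype.card V ≤ 3 * ∑ v, p v := by
  obtain ⟨R, hR⟩ := exists_fixed s p
  obtain ⟨L, hL⟩ := exists_fixed s.symm p
  have hpos : ∀ v, 1 ≤ R v + L v := by
    intro v
    by_contra h
    obtain ⟨σ, hσ, h1⟩ := hp v
    have := blocked G s hG v σ p R L (fun i => (hR i).ge) (fun i => (hL i).ge)
      (by omega) (by omega) hσ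
    omega
  have e1 := fixed_sum s p R hR
  have e2 := fixed_sum s.symm p L hL
  have e3 := Equiv.sum_comp s.symm (fun i => min (R i / 2) 2)
  have e4 := Equiv.sum_comp s (fun i => min (L i / 2) 2)
  have key : ∑ i : V, (4 + min (R i / 2) 2 + min (L i / 2) 2 + 3 * (R i / 2) + 3 * (L i / 2)) ≤
      ∑ i : V, (3 * R i + 3 * L i + min (R (s.symm i) / 2) 2 + min (L (s i) / 2) 2) := by
    apply Finset.sum_le_sum
    intro i _
    have h1 := hR (s.symm i)
    have h2 := hL (s i)
    have h3 := hpos i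
    simp only [Equiv.apply_symm_apply, Equiv.symm_apply_apply] at h1 h2
    generalize R (s.symm i) / 2 = x at *
    generalize L (s i) / 2 = y at *
    rcases Nat.eq_zero_or_pos (p i) with h4 | h4 <;> rcases Nat.eq_zero_or_pos x with h5 | h5 <;>
      rcases Nat.eq_zero_or_pos y with h6 | h6 <;> omega
  simp only [Finset.sum_add_distrib, ← Finset.mul_sum, Finset.sum_const, Finset.card_univ,
    smul_eq_mul] at key
  omega

theorem Executable.mono [DecidableEq V] {G H : SimpleGraph V} (h : G ≤ H)
    (σ : List (PMove V)) : ∀ p : V → ℕ, Executable G p σ → Executable H p σ := by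
  induction σ with
  | nil => intro p _; trivial
  | cons m ms ih => exact fun p hp => ⟨h hp.1, hp.2.1, ih _ hp.2.2⟩

theorem Solvable.mono [DecidableEq V] {G H : SimpleGraph V} (h : G ≤ H) {p : V → ℕ}
    (hp : Solvable G p) : Solvable H p := fun v => by
  obtain ⟨σ, h1, h2⟩ := hp v
  exact ⟨σ, Executable.mono h σ p h1, h2⟩

theorem reach_one_move [DecidableEq V] {G : SimpleGraph V} {p : V → ℕ} {a b : V}
    (h : G.Adj a b) (h2 : 2 ≤ p a) : Reachable' G p b := by
  refine ⟨[⟨a, b⟩], ⟨h, h2, trivial⟩, ?_⟩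
  simp [applySeq, applyMove, h.ne.symm]

/-- The optimal distribution. -/
def optDist (k i : ℕ) : ℕ := if i < 3 * k then (if i % 3 = 1 then 2 else 0) else 1

theorem optDist_sum (k r : ℕ) : ∑ i ∈ Finset.range (3 * k + r), optDist k i = 2 * k + r := by
  rw [Finset.sum_range_add]
  congr 1
  · have h : ∀ i ∈ Finset.range (3 * k), optDist k i = if i % 3 = 1 then 2 else 0 := by
      intro i hi
      simp [optDist, Finset.mem_range.mp hi]
    rw [Finset.sum_congr rfl h]
    clear h
    induction k with
    | zero => simp
    | succ k ih =>
      rw [show 3 * (k + 1) = 3 * k + 1 + 1 + 1 by ring, Finset.sum_range_succ,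
        Finset.sum_range_succ, Finset.sum_range_succ, ih, if_neg (by omega), if_pos (by omega),
        if_neg (by omega)]
      ring
  · simp [optDist]

theorem optDist_solvable (k r : ℕ) :
    Solvable (SimpleGraph.pathGraph (3 * k + r)) (fun i => optDist k i.val) := by
  intro v
  have hv := v.isLt
  by_cases h : v.val < 3 * k
  · have : v.val % 3 = 1 ∨ v.val % 3 = 0 ∨ v.val % 3 = 2 := by omega
    rcases this with h1 | h1 | h1
    · exact ⟨[], trivial, by simp [applySeq, optDist, h, h1]⟩
    · refine reach_one_move (a := ⟨v.val + 1, by omega⟩) ?_ ?_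
      · rw [SimpleGraph.pathGraph_adj]; right; rfl
      · simp only [optDist]
        rw [if_pos (by omega), if_pos (by omega)]
    · refine reach_one_move (a := ⟨v.val - 1, by omega⟩) ?_ ?_
      · rw [SimpleGraph.pathGraph_adj]; left; simp only; omega
      · simp only [optDist]
        rw [if_pos (by omega), if_pos (by omega)]
  · exact ⟨[], trivial, by simp [applySeq, optDist, h]⟩

theorem cycle_adj (n : ℕ) (hn : 1 ≤ n) : ∃ s : Equiv.Perm (Fin n),
    ∀ a b, (SimpleGraph.cycleGraph n).Adj a b → b = s a ∨ a = s b := by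
  match n, hn with
  | 1, _ => exact ⟨1, fun a b _ => Or.inl (Subsingleton.elim _ _)⟩
  | n + 2, _ =>
    refine ⟨Equiv.addRight 1, fun a b h => ?_⟩
    rw [SimpleGraph.cycleGraph_adj] at h
    rcases h with h | h
    · right; simp [← h]
    · left; simp [← h]

theorem piOpt_eq (k r : ℕ) (hr : r ≤ 2) (hpos : 1 ≤ 3 * k + r)
    (G : SimpleGraph (Fin (3 * k + r))) (h1 : SimpleGraph.pathGraph (3 * k + r) ≤ G)
    (h2 : G ≤ SimpleGraph.cycleGraph (3 * k + r)) : piOpt G = 2 * k + r := by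
  have hmem : 2 * k + r ∈ {m | ∃ p : Fin (3 * k + r) → ℕ, Solvable G p ∧ ∑ v, p v = m} :=
    ⟨_, (optDist_solvable k r).mono h1, by
      rw [Fin.sum_univ_eq_sum_range (optDist k), optDist_sum]⟩
  refine le_antisymm (Nat.sInf_le hmem) (le_csInf ⟨_, hmem⟩ ?_)
  rintro m ⟨p, hp, rfl⟩
  obtain ⟨s, hs⟩ := cycle_adj (3 * k + r) hpos
  have := lower_bound G s (fun a b h => hs a b (h2 h)) p hp
  rw [Fintype.card_fin] at this
  omega

end Helpers

/-- `π_opt(P_{3k+r}) = π_opt(C_{3k+r}) = 2k + r` for `k ≥ 0`, `0 ≤ r ≤ 2`,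
`3k + r ≥ 1`; i.e. `π_opt(P_n) = π_opt(C_n) = ⌈2n/3⌉`. -/
theorem stmt19 (k r : ℕ) (hr : r ≤ 2) (hpos : 1 ≤ 3 * k + r) :
    piOpt (SimpleGraph.pathGraph (3 * k + r)) = 2 * k + r ∧
    piOpt (SimpleGraph.cycleGraph (3 * k + r)) = 2 * k + r := by
  exact ⟨piOpt_eq k r hr hpos _ le_rfl SimpleGraph.pathGraph_le_cycleGraph,
    piOpt_eq k r hr hpos _ SimpleGraph.pathGraph_le_cycleGraph le_rfl⟩
end
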